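/- arXiv:1911.06403 — 2 statements merged into one kernel-verified Lean document; each statement's English description precedes it below -/
import Mathlib

section
/- The biplanar crossing number of K_{15,15} satisfies cr_2(K_{15,15}) ≥ 203. -/
open SimpleGraph

/-- A drawing of a simple graph `G` in the plane: an injective placement of the
vertices, together with, for each (oriented) edge, a simple arc between the images
of its endpoints that avoids all vertex images in its interior; the two
orientations of an edge are drawn by the same arc (reversed). -/
structure Drawing {V : Type*} (G : SimpleGraph V) where
  pos : V → ℝ × ℝ
  pos_inj : Function.Injective pos
  arc : ∀ ⦃u v : V⦄, G.Adj u v → Path (pos u) (pos v)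
  arc_symm : ∀ ⦃u v : V⦄ (h : G.Adj u v), arc h.symm = (arc h).symm
  arc_inj : ∀ ⦃u v : V⦄ (h : G.Adj u v), Function.Injective (arc h)
  arc_avoid : ∀ ⦃u v : V⦄ (h : G.Adj u v) (w : V) (t : unitInterval),
    arc h t = pos w → t = 0 ∨ t = 1

/-- The interior of the curve representing an edge `e` in a drawing:
the image of the open arc, excluding the endpoints. -/
def Drawing.edgeInterior {V : Type*} {G : SimpleGraph V} (D : Drawing G) (e : Sym2 V) :
    Set (ℝ × ℝ) :=
  ⋃ (u : V) (v : V) (h : G.Adj u v) (_ : e = s(u, v)),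
    (D.arc h) '' {t : unitInterval | t ≠ 0 ∧ t ≠ 1}

/-- Two edges of `G` cross in the drawing `D` if they are distinct edges of `G`
whose interiors meet. -/
def Drawing.Crosses {V : Type*} {G : SimpleGraph V} (D : Drawing G) (e f : Sym2 V) : Prop :=
  e ∈ G.edgeSet ∧ f ∈ G.edgeSet ∧ e ≠ f ∧ (D.edgeInterior e ∩ D.edgeInterior f).Nonempty

/-- The number of crossings of a drawing: the number of unordered pairs of
distinct edges that cross (in a simple/nice drawing every crossing pair of edges
crosses exactly once). -/
noncomputable def Drawing.crossCount {V : Type*} {G : SimpleGraph V} (D : Drawing G) : ℕ :=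
  {p : Sym2 V × Sym2 V | D.Crosses p.1 p.2}.ncard / 2

/-- The crossing number `cr(G)`: the minimum number of crossings over all drawings
of `G` in the plane. -/
noncomputable def crossingNumber {V : Type*} (G : SimpleGraph V) : ℕ :=
  sInf {n : ℕ | ∃ D : Drawing G, D.crossCount = n}

/-- The `k`-planar crossing number `cr_k(G)`: the minimum of
`cr(G₁) + ⋯ + cr(G_k)` over all decompositions of the edge set of `G` into `k`
edge-disjoint subgraphs `G₁, …, G_k` on the same vertex set. -/
noncomputable def kCrossingNumber {V : Type*} (k : ℕ) (G : SimpleGraph V) : ℕ :=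
  sInf {n : ℕ | ∃ f : Fin k → SimpleGraph V,
    (⨆ i, f i) = G ∧
    (∀ i j : Fin k, i ≠ j → Disjoint (f i).edgeSet (f j).edgeSet) ∧
    n = ∑ i : Fin k, crossingNumber (f i)}

section CycleSpace

variable {X Y : Type*} [DecidableEq X] [DecidableEq Y]

/-- Mod-2 incidence between an edge of a bipartite graph and a vertex. -/
def bipIncidence (e : X × Y) (w : X ⊕ Y) : ZMod 2 :=
  (if Sum.inl e.1 = w then 1 else 0) + (if Sum.inr e.2 = w then 1 else 0)

/-- The mod-2 boundary operator of the bipartite graph with edge set `R`. -/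
def bipBoundary (R : Finset (X × Y)) : (R → ZMod 2) →ₗ[ZMod 2] (X ⊕ Y → ZMod 2) where
  toFun z w := ∑ e : R, z e * bipIncidence e.1 w
  map_add' z z' := by
    ext w
    simp [add_mul, Finset.sum_add_distrib]
  map_smul' c z := by
    ext w
    simp [Finset.mul_sum, mul_assoc]

lemma bipBoundary_apply (R : Finset (X × Y)) (z : R → ZMod 2) (w : X ⊕ Y) :
    bipBoundary R z w = ∑ e : R, z e * bipIncidence e.1 w := rfl

lemma sum_bipIncidence [Fintype X] [Fintype Y] (e : X × Y) : ∑ w : X ⊕ Y, bipIncidence e w = 0 := by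
  simp [bipIncidence, Finset.sum_add_distrib]
  decide

lemma card_add_one_le_finrank_ker_add_card [Fintype X] [Fintype Y] (R : Finset (X × Y))
    (hn : 0 < Fintype.card X + Fintype.card Y) :
    R.card + 1 ≤ Module.finrank (ZMod 2) (bipBoundary R).ker
      + (Fintype.card X + Fintype.card Y) := by
  classical
  have h1 := LinearMap.finrank_range_add_finrank_ker (bipBoundary R)
  let σ : (X ⊕ Y → ZMod 2) →ₗ[ZMod 2] ZMod 2 := ∑ w, LinearMap.proj w
  have hσ (u : X ⊕ Y → ZMod 2) : σ u = ∑ w, u w := by simp [σ]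
  have h2 := LinearMap.finrank_range_add_finrank_ker σ
  have hsurj : σ.range = ⊤ := by
    rw [LinearMap.range_eq_top]
    intro c
    have : Nonempty (X ⊕ Y) := by
      rw [← Fintype.card_pos_iff, Fintype.card_sum]; exact hn
    obtain ⟨w⟩ := this
    exact ⟨Pi.single w c, by rw [hσ]; simp⟩
  have hle : (bipBoundary R).range ≤ σ.ker := by
    rintro _ ⟨z, rfl⟩
    rw [LinearMap.mem_ker, hσ]
    simp_rw [bipBoundary_apply]
    rw [Finset.sum_comm]
    exact Finset.sum_eq_zero fun e _ => by rw [← Finset.mul_sum, sum_bipIncidence, mul_zero]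
  have h3 := Submodule.finrank_mono hle
  rw [hsurj] at h2
  simp at h1 h2
  omega

lemma exists_other_of_sum_eq_zero {ι : Type*} [Fintype ι] [DecidableEq ι] (g : ι → ZMod 2)
    (hg : ∑ i, g i = 0) (i : ι) (hi : g i ≠ 0) : ∃ j, j ≠ i ∧ g j ≠ 0 := by
  by_contra! h
  rw [Finset.sum_eq_single i (fun j _ hj => h j hj) (by simp)] at hg
  exact hi hg

/-- Nonzero even subgraphs of a simple bipartite graph have at least four edges. -/
lemma four_le_card_support (R : Finset (X × Y)) (z : R → ZMod 2) (hz : bipBoundary R z = 0)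
    (hne : z ≠ 0) : 4 ≤ (Finset.univ.filter fun e => z e ≠ 0).card := by
  obtain ⟨e₀, he₀⟩ := Function.ne_iff.mp hne
  have row (e : R) (he : z e ≠ 0) : ∃ f : R, z f ≠ 0 ∧ f.1.1 = e.1.1 ∧ f.1.2 ≠ e.1.2 := by
    have h := congrFun hz (Sum.inl e.1.1)
    rw [bipBoundary_apply] at h
    obtain ⟨f, hf, hf'⟩ := exists_other_of_sum_eq_zero _ h e (by simpa [bipIncidence] using he)
    have h1 : f.1.1 = e.1.1 := by
      by_contra hc
      simp [bipIncidence, hc] at hf'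
    refine ⟨f, fun hc => by simp [hc] at hf', h1, fun h2 => hf (Subtype.ext (Prod.ext h1 h2))⟩
  have col (e : R) (he : z e ≠ 0) : ∃ f : R, z f ≠ 0 ∧ f.1.2 = e.1.2 ∧ f.1.1 ≠ e.1.1 := by
    have h := congrFun hz (Sum.inr e.1.2)
    rw [bipBoundary_apply] at h
    obtain ⟨f, hf, hf'⟩ := exists_other_of_sum_eq_zero _ h e (by simpa [bipIncidence] using he)
    have h1 : f.1.2 = e.1.2 := by
      by_contra hc
      simp [bipIncidence, hc] at hf'
    refine ⟨f, fun hc => by simp [hc] at hf', h1, fun h2 => hf (Subtype.ext (Prod.ext h2 h1))⟩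
  obtain ⟨e₁, h₁, h₁x, h₁y⟩ := row e₀ he₀
  obtain ⟨e₂, h₂, h₂y, h₂x⟩ := col e₀ he₀
  obtain ⟨e₃, h₃, h₃y, h₃x⟩ := col e₁ h₁
  have hsub : ({e₀, e₁, e₂, e₃} : Finset R) ⊆ Finset.univ.filter fun e => z e ≠ 0 := by
    intro e he
    simp only [Finset.mem_insert, Finset.mem_singleton] at he
    rcases he with rfl | rfl | rfl | rfl <;> simp_all
  have h01 : e₀ ≠ e₁ := by rintro rfl; exact h₁y rfl
  have h02 : e₀ ≠ e₂ := by rintro rfl; exact h₂x rfl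
  have h03 : e₀ ≠ e₃ := by rintro rfl; exact h₃x h₁x.symm
  have h12 : e₁ ≠ e₂ := by rintro rfl; exact h₂x h₁x
  have h13 : e₁ ≠ e₃ := by rintro rfl; exact h₃x rfl
  have h23 : e₂ ≠ e₃ := by rintro rfl; exact h₁y (h₃y.symm.trans h₂y)
  have hcard : ({e₀, e₁, e₂, e₃} : Finset R).card = 4 := by
    rw [Finset.card_insert_of_notMem, Finset.card_insert_of_notMem,
      Finset.card_pair h23] <;> simp [*]
  exact hcard ▸ Finset.card_le_card hsub

/-- Euler's bound for a simple bipartite graph whose cycle space is exactly the space of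
coboundaries of a dual graph, `l` and `r` giving the two faces next to each edge. -/
theorem card_add_four_le_of_dual [Fintype X] [Fintype Y] {Φ : Type*}
    (R : Finset (X × Y)) (l r : R → Φ)
    (hcob : ∀ f : Φ → ZMod 2, bipBoundary R (fun e => f (l e) + f (r e)) = 0)
    (hcyc : ∀ z, bipBoundary R z = 0 → ∃ f : Φ → ZMod 2, ∀ e, z e = f (l e) + f (r e))
    (hn : 3 ≤ Fintype.card X + Fintype.card Y) :
    R.card + 4 ≤ 2 * (Fintype.card X + Fintype.card Y) := by
  classical
  have hdim := card_add_one_le_finrank_ker_add_card R (by omega)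
  let b (φ : Φ) : R → ZMod 2 :=
    fun e => (if l e = φ then 1 else 0) + (if r e = φ then 1 else 0)
  have hb (φ : Φ) : bipBoundary R (b φ) = 0 := hcob (fun ψ => if ψ = φ then 1 else 0)
  let Ψ : Finset Φ := Finset.univ.image l ∪ Finset.univ.image r
  have hl (e : R) : l e ∈ Ψ := by simp [Ψ]
  have hr (e : R) : r e ∈ Ψ := by simp [Ψ]
  have hexp (f : Φ → ZMod 2) (e : R) : f (l e) + f (r e) = ∑ φ ∈ Ψ, f φ * b φ e := by
    simp [b, mul_add, Finset.sum_add_distrib, hl, hr]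
  let N := Ψ.filter fun φ => b φ ≠ 0
  have hcount : 4 * N.card ≤ 2 * R.card := by
    have h1 : ∑ φ ∈ N, 4 ≤ ∑ φ ∈ N, (Finset.univ.filter fun e => b φ e ≠ 0).card :=
      Finset.sum_le_sum fun φ hφ => four_le_card_support R _ (hb φ) (Finset.mem_filter.mp hφ).2
    have h2 : ∑ φ ∈ N, (Finset.univ.filter fun e => b φ e ≠ 0).card
        = ∑ e : R, (N.filter fun φ => b φ e ≠ 0).card :=
      Finset.sum_card_bipartiteAbove_eq_sum_card_bipartiteBelow _
    have h3 : ∑ e : R, (N.filter fun φ => b φ e ≠ 0).card ≤ ∑ _e : R, 2 := by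
      refine Finset.sum_le_sum fun e _ => ?_
      refine (Finset.card_le_card (t := {l e, r e}) fun φ hφ => ?_).trans Finset.card_le_two
      have := (Finset.mem_filter.mp hφ).2
      by_contra hc
      simp only [Finset.mem_insert, Finset.mem_singleton, not_or] at hc
      exact this (by simp [b, Ne.symm hc.1, Ne.symm hc.2])
    rw [h2] at h1
    have h4 := h1.trans h3
    simp only [Finset.sum_const, smul_eq_mul, Finset.card_univ, Fintype.card_coe] at h4
    omega
  have hspan : Module.finrank (ZMod 2) (bipBoundary R).ker ≤ N.card - 1 := by
    rcases N.eq_empty_or_nonempty with h0 | ⟨φ₀, hφ₀⟩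
    · have : (bipBoundary R).ker = ⊥ := by
        rw [eq_bot_iff]
        intro z hz
        obtain ⟨f, hf⟩ := hcyc z hz
        rw [Submodule.mem_bot]
        ext e
        rw [hf, hexp]
        refine Finset.sum_eq_zero fun φ hφ => ?_
        have hφ0 : b φ = 0 := by
          by_contra hc
          have : φ ∈ N := Finset.mem_filter.mpr ⟨hφ, hc⟩
          simp [h0] at this
        simp [hφ0]
      rw [this, finrank_bot]
      exact Nat.zero_le _
    · rw [← Finset.card_erase_of_mem hφ₀]
      have hle : (bipBoundary R).ker ≤
          Submodule.span (ZMod 2) (((N.erase φ₀).image b : Finset _) : Set (R → ZMod 2)) := by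
        intro z hz
        obtain ⟨f, hf⟩ := hcyc z hz
        have hz' : z = ∑ φ ∈ N.erase φ₀, (f φ + f φ₀) • b φ := by
          ext e
          have h1 : z e = (f (l e) + f φ₀) + (f (r e) + f φ₀) := by
            rw [hf, add_add_add_comm, CharTwo.add_self_eq_zero, add_zero]
          rw [h1, hexp fun φ => f φ + f φ₀, Finset.sum_apply]
          symm
          refine Finset.sum_subset ((Finset.erase_subset _ _).trans (Finset.filter_subset _ _)) ?_
          intro φ hφ hφ'
          by_cases h : φ = φ₀
          · simp [h, CharTwo.add_self_eq_zero]
          · have : b φ = 0 := by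
              by_contra hc
              exact hφ' (Finset.mem_erase.mpr ⟨h, Finset.mem_filter.mpr ⟨hφ, hc⟩⟩)
            simp [this]
        rw [hz']
        refine Submodule.sum_mem _ fun φ hφ => Submodule.smul_mem _ _ (Submodule.subset_span ?_)
        exact Finset.mem_coe.mpr (Finset.mem_image_of_mem b hφ)
      exact (Submodule.finrank_mono hle).trans
        ((finrank_span_finset_le_card _).trans Finset.card_image_le)
  omega

end CycleSpace

section Grid

/-- Edges of the square grid: `(true, p)` joins `p` to its right neighbour and `(false, p)`
joins `p` to its upper neighbour. -/
abbrev GridEdge := Bool × ℤ × ℤ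

namespace GridEdge

/-- The first endpoint of a grid edge. -/
def src (e : GridEdge) : ℤ × ℤ := e.2

/-- The second endpoint of a grid edge. -/
def tgt (e : GridEdge) : ℤ × ℤ := if e.1 then (e.2.1 + 1, e.2.2) else (e.2.1, e.2.2 + 1)

/-- The unit square on one side of a grid edge, named by its lower left corner. -/
def left (e : GridEdge) : ℤ × ℤ := e.2

/-- The unit square on the other side of a grid edge. -/
def right (e : GridEdge) : ℤ × ℤ := if e.1 then (e.2.1, e.2.2 - 1) else (e.2.1 - 1, e.2.2)

lemma src_ne_tgt (e : GridEdge) : e.src ≠ e.tgt := by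
  obtain ⟨b, i, j⟩ := e
  cases b <;> simp [src, tgt]

end GridEdge

/-- The square grid graph. -/
def gridGraph : SimpleGraph (ℤ × ℤ) where
  Adj p q := ∃ e : GridEdge, (e.src = p ∧ e.tgt = q) ∨ (e.src = q ∧ e.tgt = p)
  symm := ⟨fun _ _ ⟨e, h⟩ => ⟨e, h.symm⟩⟩
  loopless := ⟨fun p ⟨e, h⟩ => by
    rcases h with ⟨h1, h2⟩ | ⟨h1, h2⟩ <;> exact e.src_ne_tgt (h1.trans h2.symm)⟩

/-- The mod-2 boundary operator of the grid. -/
noncomputable def gridBoundary : (GridEdge →₀ ZMod 2) →ₗ[ZMod 2] (ℤ × ℤ →₀ ZMod 2) :=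
  Finsupp.linearCombination (ZMod 2) fun e : GridEdge =>
    Finsupp.single e.src 1 + Finsupp.single e.tgt 1

lemma gridBoundary_single (e : GridEdge) :
    gridBoundary (Finsupp.single e 1) = Finsupp.single e.src 1 + Finsupp.single e.tgt 1 := by
  simp [gridBoundary]

lemma gridBoundary_apply (c : GridEdge →₀ ZMod 2) (i j : ℤ) :
    gridBoundary c (i, j) =
      c (true, i, j) + c (true, i - 1, j) + c (false, i, j) + c (false, i, j - 1) := by
  induction c using Finsupp.induction_linear with
  | zero => simp
  | add c d hc hd => rw [map_add, Finsupp.add_apply, hc, hd]; simp only [Finsupp.add_apply]; ring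
  | single e a =>
    obtain ⟨b, k, l⟩ := e
    have h1 : k + 1 = i ↔ k = i - 1 := by omega
    have h2 : l + 1 = j ↔ l = j - 1 := by omega
    cases b <;>
      simp [gridBoundary, GridEdge.src, GridEdge.tgt, Finsupp.single_apply, h1, h2]

/-- The discrete Poincaré lemma: a finite mod-2 cycle of the grid bounds a set of squares. -/
lemma exists_potential (c : GridEdge →₀ ZMod 2) (hc : gridBoundary c = 0) :
    ∃ f : ℤ × ℤ → ZMod 2, ∀ e : GridEdge, c e = f e.left + f e.right := by
  obtain ⟨m, hm⟩ := (c.support.image fun e => e.2.1).bddBelow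
  have hzero (b : Bool) (i j : ℤ) (hi : i < m) : c (b, i, j) = 0 := by
    by_contra h
    have := hm (Finset.mem_coe.mpr (Finset.mem_image_of_mem _ (Finsupp.mem_support_iff.mpr h)))
    dsimp only at this
    omega
  let f (p : ℤ × ℤ) : ZMod 2 := ∑ k ∈ Finset.Ioc (m - 1) p.1, c (false, k, p.2)
  have hlow (i j : ℤ) (hi : i < m) : f (i, j) = 0 := by
    simp only [f]
    rw [Finset.Ioc_eq_empty (by omega), Finset.sum_empty]
  have hstep (i j : ℤ) : f (i, j) = f (i - 1, j) + c (false, i, j) := by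
    by_cases hi : i < m
    · rw [hlow _ _ hi, hlow _ _ (by omega), hzero _ _ _ hi, add_zero]
    · have : Finset.Ioc (m - 1) i = insert i (Finset.Ioc (m - 1) (i - 1)) := by
        ext k
        simp only [Finset.mem_Ioc, Finset.mem_insert]
        omega
      simp only [f]
      rw [this, Finset.sum_insert (by simp), add_comm]
  have hhor (j i : ℤ) (hi : m - 1 ≤ i) : c (true, i, j) = f (i, j) + f (i, j - 1) := by
    induction i, hi using Int.leInduction with
    | base => rw [hlow _ _ (by omega), hlow _ _ (by omega), hzero _ _ _ (by omega), add_zero]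
    | succ i hi ih =>
      have h := DFunLike.congr_fun hc (i + 1, j)
      rw [gridBoundary_apply, Finsupp.zero_apply, add_sub_cancel_right, add_assoc, add_assoc] at h
      rw [hstep (i + 1) j, hstep (i + 1) (j - 1), add_sub_cancel_right, CharTwo.add_eq_zero.mp h,
        ih]
      ring
  refine ⟨f, ?_⟩
  rintro ⟨b, i, j⟩
  cases b
  · simp only [GridEdge.left, GridEdge.right, Bool.false_eq_true, if_false]
    rw [hstep i j, add_right_comm, CharTwo.add_self_eq_zero, zero_add]
  · simp only [GridEdge.left, GridEdge.right, if_true]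
    by_cases hi : m - 1 ≤ i
    · exact hhor j i hi
    · rw [hlow _ _ (by omega), hlow _ _ (by omega), hzero _ _ _ (by omega), add_zero]

/-- Finitely supported coboundaries of the grid are cycles. -/
lemma gridBoundary_eq_zero_of_coboundary (c : GridEdge →₀ ZMod 2) (f : ℤ × ℤ → ZMod 2)
    (hf : ∀ e : GridEdge, c e = f e.left + f e.right) : gridBoundary c = 0 := by
  ext ⟨i, j⟩
  rw [gridBoundary_apply]
  simp only [hf, GridEdge.left, GridEdge.right, Bool.false_eq_true, if_false, if_true,
    Finsupp.zero_apply]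
  ring_nf
  simp [show (2 : ZMod 2) = 0 from rfl]

lemma single_add_single_self (p : ℤ × ℤ) :
    (Finsupp.single p 1 + Finsupp.single p 1 : ℤ × ℤ →₀ ZMod 2) = 0 := by
  rw [← Finsupp.single_add, CharTwo.add_self_eq_zero, Finsupp.single_zero]

lemma exists_chain_of_preconnected {S : Set (ℤ × ℤ)} (hS : (gridGraph.induce S).Preconnected)
    {p q : ℤ × ℤ} (hp : p ∈ S) (hq : q ∈ S) :
    ∃ c : GridEdge →₀ ZMod 2,
      gridBoundary c = Finsupp.single p 1 + Finsupp.single q 1 ∧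
        ∀ e : GridEdge, c e ≠ 0 → e.src ∈ S ∧ e.tgt ∈ S := by
  obtain ⟨w⟩ := hS ⟨p, hp⟩ ⟨q, hq⟩
  suffices H : ∀ x y : S, (gridGraph.induce S).Walk x y → ∃ c : GridEdge →₀ ZMod 2,
      gridBoundary c = Finsupp.single x.1 1 + Finsupp.single y.1 1 ∧
        ∀ e : GridEdge, c e ≠ 0 → e.src ∈ S ∧ e.tgt ∈ S from H _ _ w
  intro x y w
  induction w with
  | nil => exact ⟨0, by rw [single_add_single_self, map_zero], by simp⟩
  | @cons x z y hxz _ ih =>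
    obtain ⟨c, hc, hcS⟩ := ih
    obtain ⟨e, he⟩ : gridGraph.Adj x.1 z.1 := hxz
    have hb : gridBoundary (Finsupp.single e 1) = Finsupp.single x.1 1 + Finsupp.single z.1 1 := by
      rw [gridBoundary_single]
      rcases he with ⟨h1, h2⟩ | ⟨h1, h2⟩
      · rw [h1, h2]
      · rw [h1, h2, add_comm]
    refine ⟨c + Finsupp.single e 1, ?_, fun e' he' => ?_⟩
    · rw [map_add, hc, hb, add_comm, add_assoc, ← add_assoc (Finsupp.single z.1 1),
        single_add_single_self, zero_add]
    · by_cases h : e = e'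
      · subst h
        rcases he with ⟨h1, h2⟩ | ⟨h1, h2⟩
        · exact ⟨h1 ▸ x.2, h2 ▸ z.2⟩
        · exact ⟨h1 ▸ z.2, h2 ▸ x.2⟩
      · exact hcS e' (by simpa [Finsupp.single_apply, h] using he')

/-- Some vertex of `S` is adjacent in the grid to some vertex of `T`. -/
def Touches (S T : Set (ℤ × ℤ)) : Prop := ∃ p ∈ S, ∃ q ∈ T, gridGraph.Adj p q

lemma Touches.symm {S T : Set (ℤ × ℤ)} (h : Touches S T) : Touches T S := by
  obtain ⟨p, hp, q, hq, hpq⟩ := h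
  exact ⟨q, hq, p, hp, hpq.symm⟩

lemma Touches.mono {S S' T T' : Set (ℤ × ℤ)} (h : Touches S T) (hS : S ⊆ S') (hT : T ⊆ T') :
    Touches S' T' := by
  obtain ⟨p, hp, q, hq, hpq⟩ := h
  exact ⟨p, hS hp, q, hT hq, hpq⟩

/-- A bipartite graph which is a minor of the grid satisfies the planar edge bound. -/
theorem card_add_four_le_of_grid_minor {X Y : Type*} [Fintype X] [Fintype Y] [DecidableEq X]
    [DecidableEq Y] (S : X ⊕ Y → Set (ℤ × ℤ)) (hfin : ∀ w, (S w).Finite)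
    (hconn : ∀ w, (gridGraph.induce (S w)).Connected)
    (hdisj : ∀ w w' p, p ∈ S w → p ∈ S w' → w = w') (R : Finset (X × Y))
    (hR : ∀ e ∈ R, Touches (S (Sum.inl e.1)) (S (Sum.inr e.2)))
    (hn : 3 ≤ Fintype.card X + Fintype.card Y) :
    R.card + 4 ≤ 2 * (Fintype.card X + Fintype.card Y) := by
  classical
  have hex (e : R) : ∃ g : GridEdge,
      (g.src ∈ S (Sum.inl e.1.1) ∧ g.tgt ∈ S (Sum.inr e.1.2)) ∨
      (g.src ∈ S (Sum.inr e.1.2) ∧ g.tgt ∈ S (Sum.inl e.1.1)) := by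
    obtain ⟨p, hp, q, hq, g, hg⟩ := hR e.1 e.2
    refine ⟨g, ?_⟩
    rcases hg with ⟨rfl, rfl⟩ | ⟨rfl, rfl⟩
    · exact Or.inl ⟨hp, hq⟩
    · exact Or.inr ⟨hq, hp⟩
  choose lift hlift using hex
  have hinj : Function.Injective lift := by
    intro e e' h
    have h1 := hlift e
    have h2 := hlift e'
    rw [h] at h1
    rcases h1 with ⟨a, b⟩ | ⟨a, b⟩ <;> rcases h2 with ⟨a', b'⟩ | ⟨a', b'⟩
    · exact Subtype.ext (Prod.ext (Sum.inl_injective (hdisj _ _ _ a a'))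
        (Sum.inr_injective (hdisj _ _ _ b b')))
    · exact absurd (hdisj _ _ _ a a') Sum.inl_ne_inr
    · exact absurd (hdisj _ _ _ a a') Sum.inr_ne_inl
    · exact Subtype.ext (Prod.ext (Sum.inl_injective (hdisj _ _ _ b b'))
        (Sum.inr_injective (hdisj _ _ _ a a')))
  have hnot (e : R) (w : X ⊕ Y) (h1 : (lift e).src ∈ S w) (h2 : (lift e).tgt ∈ S w) : False := by
    rcases hlift e with ⟨a, b⟩ | ⟨a, b⟩
    · exact Sum.inl_ne_inr ((hdisj _ _ _ a h1).trans (hdisj _ _ _ h2 b))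
    · exact Sum.inr_ne_inl ((hdisj _ _ _ a h1).trans (hdisj _ _ _ h2 b))
  let U : Set GridEdge := {g | (∃ w, g.src ∈ S w ∧ g.tgt ∈ S w) ∨ g ∈ Set.range lift}
  have hU : U.Finite := by
    have hsub : U ⊆ (Set.univ : Set Bool) ×ˢ ⋃ w, S w := by
      rintro g (⟨w, h, -⟩ | ⟨e, rfl⟩)
      · exact ⟨trivial, Set.mem_iUnion.mpr ⟨w, h⟩⟩
      · rcases hlift e with ⟨a, -⟩ | ⟨a, -⟩ <;> exact ⟨trivial, Set.mem_iUnion.mpr ⟨_, a⟩⟩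
    exact (Set.finite_univ.prod (Set.finite_iUnion hfin)).subset hsub
  let ind (w : X ⊕ Y) (p : ℤ × ℤ) : ZMod 2 := if p ∈ S w then 1 else 0
  have hind (v w : X ⊕ Y) (p : ℤ × ℤ) (hp : p ∈ S v) : ind w p = if v = w then 1 else 0 := by
    by_cases h : v = w
    · subst h; simp [ind, hp]
    · have : p ∉ S w := fun h' => h (hdisj _ _ _ hp h')
      simp [ind, h, this]
  have hcount (c : GridEdge →₀ ZMod 2) (hc : ∀ g ∉ U, c g = 0) (hb : gridBoundary c = 0) :
      bipBoundary R (fun e => c (lift e)) = 0 := by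
    ext w
    have h0 : Finsupp.linearCombination (ZMod 2) (ind w) (gridBoundary c) = 0 := by
      rw [hb, map_zero]
    have h1 : Finsupp.linearCombination (ZMod 2) (ind w) (gridBoundary c) =
        ∑ g ∈ hU.toFinset, c g * (ind w g.src + ind w g.tgt) := by
      have h2 : gridBoundary c =
          ∑ g ∈ c.support, c g • (Finsupp.single g.src 1 + Finsupp.single g.tgt 1) := by
        rw [gridBoundary, Finsupp.linearCombination_apply, Finsupp.sum]
      rw [h2, map_sum]
      refine (Finset.sum_subset (fun g hg => ?_) (fun g _ hg => ?_)).trans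
        (Finset.sum_congr rfl fun g _ => ?_)
      · rw [Set.Finite.mem_toFinset]
        by_contra h
        exact Finsupp.mem_support_iff.mp hg (hc g h)
      · simp [Finsupp.notMem_support_iff.mp hg]
      · simp [mul_add]
    have h2 : ∑ g ∈ Finset.univ.image lift, c g * (ind w g.src + ind w g.tgt) =
        ∑ g ∈ hU.toFinset, c g * (ind w g.src + ind w g.tgt) := by
      refine Finset.sum_subset (fun g hg => ?_) (fun g hg hg' => ?_)
      · rw [Set.Finite.mem_toFinset]
        obtain ⟨e, -, rfl⟩ := Finset.mem_image.mp hg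
        exact Or.inr ⟨e, rfl⟩
      · rw [Set.Finite.mem_toFinset] at hg
        rcases hg with ⟨v, ha, hb⟩ | ⟨e, rfl⟩
        · rw [hind v w _ ha, hind v w _ hb, CharTwo.add_self_eq_zero, mul_zero]
        · exact absurd (Finset.mem_image_of_mem _ (Finset.mem_univ e)) hg'
    rw [← h1, h0, Finset.sum_image fun _ _ _ _ h => hinj h] at h2
    rw [bipBoundary_apply, Pi.zero_apply, ← h2]
    refine Finset.sum_congr rfl fun e _ => ?_
    rw [bipIncidence]
    rcases hlift e with ⟨a, b⟩ | ⟨a, b⟩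
    · rw [hind _ w _ a, hind _ w _ b]
    · rw [hind _ w _ a, hind _ w _ b, add_comm]
  let r : ℤ × ℤ → ℤ × ℤ → Prop := fun s t => ∃ g : GridEdge, g ∉ U ∧ g.left = s ∧ g.right = t
  refine card_add_four_le_of_dual R (fun e => Quot.mk r (lift e).left)
    (fun e => Quot.mk r (lift e).right) (fun f => ?_) (fun z hz => ?_) hn
  · have hoff (g : GridEdge) (hg : g ∉ U) :
        f (Quot.mk r g.left) + f (Quot.mk r g.right) = 0 := by
      rw [Quot.sound (show r g.left g.right from ⟨g, hg, rfl, rfl⟩), CharTwo.add_self_eq_zero]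
    let c : GridEdge →₀ ZMod 2 := Finsupp.onFinset hU.toFinset
      (fun g => f (Quot.mk r g.left) + f (Quot.mk r g.right)) (fun g hg => by
        rw [Set.Finite.mem_toFinset]
        by_contra h
        exact hg (hoff g h))
    exact hcount c hoff (gridBoundary_eq_zero_of_coboundary c (fun p => f (Quot.mk r p))
      fun g => rfl)
  · have hroot (w : X ⊕ Y) : ∃ p, p ∈ S w := by
      obtain ⟨p⟩ := (hconn w).nonempty
      exact ⟨p.1, p.2⟩
    choose root hroot using hroot
    have hchain (e : R) : ∃ c : GridEdge →₀ ZMod 2,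
        gridBoundary c = Finsupp.single (root (Sum.inl e.1.1)) 1 +
          Finsupp.single (root (Sum.inr e.1.2)) 1 ∧
        (∀ g ∉ U, c g = 0) ∧ ∀ e', c (lift e') = if e = e' then 1 else 0 := by
      have key (v v' : X ⊕ Y) (hv : (lift e).src ∈ S v) (hv' : (lift e).tgt ∈ S v') :
          ∃ c : GridEdge →₀ ZMod 2,
          gridBoundary c = Finsupp.single (root v) 1 + Finsupp.single (root v') 1 ∧
          (∀ g ∉ U, c g = 0) ∧ ∀ e', c (lift e') = if e = e' then 1 else 0 := by
        obtain ⟨c, hc, hcS⟩ := exists_chain_of_preconnected (hconn v).preconnected (hroot v) hv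
        obtain ⟨d, hd, hdS⟩ := exists_chain_of_preconnected (hconn v').preconnected hv' (hroot v')
        refine ⟨c + Finsupp.single (lift e) 1 + d, ?_, fun g hg => ?_, fun e' => ?_⟩
        · rw [map_add, map_add, hc, hd, gridBoundary_single]
          have h1 := single_add_single_self (lift e).src
          have h2 := single_add_single_self (lift e).tgt
          generalize (Finsupp.single (lift e).src 1 : ℤ × ℤ →₀ ZMod 2) = a at *
          generalize (Finsupp.single (lift e).tgt 1 : ℤ × ℤ →₀ ZMod 2) = b at *
          rw [add_assoc, add_assoc, add_assoc, ← add_assoc b, h2, zero_add, ← add_assoc a, h1,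
            zero_add]
        · have h1 : c g = 0 := by
            by_contra h
            exact hg (Or.inl ⟨v, hcS g h⟩)
          have h2 : d g = 0 := by
            by_contra h
            exact hg (Or.inl ⟨v', hdS g h⟩)
          have h3 : lift e ≠ g := fun h => hg (Or.inr ⟨e, h⟩)
          simp [h1, h2, h3]
        · have h1 : c (lift e') = 0 := by
            by_contra h
            exact hnot e' v (hcS _ h).1 (hcS _ h).2
          have h2 : d (lift e') = 0 := by
            by_contra h
            exact hnot e' v' (hdS _ h).1 (hdS _ h).2
          simp [h1, h2, Finsupp.single_apply, hinj.eq_iff]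
      rcases hlift e with ⟨a, b⟩ | ⟨a, b⟩
      · exact key _ _ a b
      · obtain ⟨c, hc, h⟩ := key _ _ a b
        exact ⟨c, by rw [hc, add_comm], h⟩
    choose chain hchain hoff heval using hchain
    let c : GridEdge →₀ ZMod 2 := ∑ e : R, z e • chain e
    have hc (g : GridEdge) : c g = ∑ e : R, z e * chain e g := by
      simp [c, Finsupp.finsetSum_apply]
    have hcU (g : GridEdge) (hg : g ∉ U) : c g = 0 := by
      rw [hc]
      exact Finset.sum_eq_zero fun e _ => by rw [hoff e g hg, mul_zero]
    have hce (e : R) : c (lift e) = z e := by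
      rw [hc]
      simp [heval]
    have hb : gridBoundary c = 0 := by
      have h1 : ∑ w : X ⊕ Y, bipBoundary R z w •
          (Finsupp.single (root w) 1 : ℤ × ℤ →₀ ZMod 2) = 0 := by
        simp [hz]
      rw [← h1, map_sum]
      simp only [map_smul, hchain, bipBoundary_apply, Finset.sum_smul]
      rw [Finset.sum_comm]
      refine Finset.sum_congr rfl fun e _ => ?_
      simp only [mul_smul, ← Finset.smul_sum]
      congr 1
      simp [bipIncidence, add_smul, Finset.sum_add_distrib, -Fintype.sum_sum_type]
    obtain ⟨f, hf⟩ := exists_potential c hb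
    refine ⟨Quot.lift f ?_, fun e => ?_⟩
    · rintro _ _ ⟨g, hg, rfl, rfl⟩
      have := hf g
      rw [hcU g hg] at this
      exact CharTwo.add_eq_zero.mp this.symm
    · rw [← hce e, hf]

end Grid

section Models

/-- Connectedness of a set of grid points. -/
def GridConnected (S : Set (ℤ × ℤ)) : Prop := (gridGraph.induce S).Connected

lemma GridConnected.union_of_inter {S T : Set (ℤ × ℤ)} (hS : GridConnected S)
    (hT : GridConnected T) (h : (S ∩ T).Nonempty) : GridConnected (S ∪ T) :=
  SimpleGraph.induce_union_connected hS.preconnected hT.preconnected h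

lemma gridConnected_singleton (p : ℤ × ℤ) : GridConnected {p} := by
  rw [GridConnected, SimpleGraph.connected_iff]
  exact ⟨fun x y => by rw [Subsingleton.elim x y], ⟨⟨p, rfl⟩⟩⟩

lemma GridConnected.union_of_touches {S T : Set (ℤ × ℤ)} (hS : GridConnected S)
    (hT : GridConnected T) (h : Touches S T) : GridConnected (S ∪ T) := by
  obtain ⟨p, hp, q, hq, hpq⟩ := h
  have h1 : GridConnected {p, q} := SimpleGraph.induce_pair_connected_of_adj hpq
  have h2 : GridConnected (S ∪ {p, q}) := hS.union_of_inter h1 ⟨p, hp, by simp⟩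
  have h3 := h2.union_of_inter hT ⟨q, by simp, hq⟩
  convert h3 using 1
  ext x
  simp only [Set.mem_union, Set.mem_insert_iff, Set.mem_singleton_iff]
  constructor
  · tauto
  · rintro ((h | rfl | rfl) | h) <;> tauto

/-- A discretised drawing of a bipartite graph: every vertex and every edge is a finite connected
set of grid points, and an edge set touches the vertex sets of its two endpoints. -/
structure GridModel (A B : Type*) (R : Finset (A × B)) where
  vert : A ⊕ B → Set (ℤ × ℤ)
  edge : A × B → Set (ℤ × ℤ)
  vert_finite : ∀ v, (vert v).Finite
  vert_connected : ∀ v, GridConnected (vert v)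
  vert_disjoint : ∀ v w p, p ∈ vert v → p ∈ vert w → v = w
  edge_finite : ∀ e ∈ R, (edge e).Finite
  edge_connected : ∀ e ∈ R, GridConnected (edge e)
  edge_vert_disjoint : ∀ e ∈ R, ∀ v p, p ∈ edge e → p ∉ vert v
  touches_left : ∀ e ∈ R, Touches (edge e) (vert (Sum.inl e.1))
  touches_right : ∀ e ∈ R, Touches (edge e) (vert (Sum.inr e.2))

namespace GridModel

variable {A B : Type*} {R : Finset (A × B)} (M : GridModel A B R)

/-- Two distinct edges cross in a grid model if their point sets meet. -/
def Cross (e f : A × B) : Prop := e ≠ f ∧ (M.edge e ∩ M.edge f).Nonempty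

variable {M} in
lemma Cross.symm {e f : A × B} (h : M.Cross e f) : M.Cross f e :=
  ⟨h.1.symm, by rw [Set.inter_comm]; exact h.2⟩

/-- The grid points used by a set of edges. -/
def territory (E : Finset (A × B)) : Set (ℤ × ℤ) := ⋃ e ∈ E, M.edge e

lemma mem_territory {E : Finset (A × B)} {p : ℤ × ℤ} :
    p ∈ M.territory E ↔ ∃ e ∈ E, p ∈ M.edge e := by
  simp [territory]

lemma territory_mono {E F : Finset (A × B)} (h : E ⊆ F) : M.territory E ⊆ M.territory F := by
  intro p
  simp only [mem_territory]
  exact fun ⟨e, he, hp⟩ => ⟨e, h he, hp⟩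

lemma edge_subset_territory {E : Finset (A × B)} {e : A × B} (he : e ∈ E) :
    M.edge e ⊆ M.territory E := fun _ hp => M.mem_territory.mpr ⟨e, he, hp⟩

lemma territory_finite {E : Finset (A × B)} (hE : E ⊆ R) : (M.territory E).Finite :=
  E.finite_toSet.biUnion fun e he => M.edge_finite e (hE he)

lemma territory_vert {E : Finset (A × B)} (hE : E ⊆ R) {p : ℤ × ℤ} (hp : p ∈ M.territory E)
    (v : A ⊕ B) : p ∉ M.vert v := by
  obtain ⟨e, he, hp⟩ := M.mem_territory.mp hp
  exact M.edge_vert_disjoint e (hE he) v p hp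

/-- The edges in `D` can be realised simultaneously by enlarging vertex sets within the
territory of `E`. -/
def DirectIn (E D : Finset (A × B)) : Prop :=
  ∃ T : A ⊕ B → Set (ℤ × ℤ), (∀ v, T v ⊆ M.territory E) ∧
    (∀ v w p, p ∈ T v → p ∈ T w → v = w) ∧ (∀ v, GridConnected (M.vert v ∪ T v)) ∧
    ∀ e ∈ D, Touches (M.vert (Sum.inl e.1) ∪ T (Sum.inl e.1))
      (M.vert (Sum.inr e.2) ∪ T (Sum.inr e.2))

/-- Disjoint connected clusters inside the territory of `E` are incident with `g` more vertices
than twice their number. -/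
def ClusterIn (E : Finset (A × B)) (g : ℕ) : Prop :=
  ∃ (ι : Type) (_ : Fintype ι) (C : ι → Set (ℤ × ℤ)) (N : ι → Finset (A ⊕ B)),
    (∀ i, C i ⊆ M.territory E) ∧ (∀ i j p, p ∈ C i → p ∈ C j → i = j) ∧
    (∀ i, GridConnected (C i)) ∧ (∀ i, ∀ v ∈ N i, Touches (M.vert v) (C i)) ∧
    g + 2 * Fintype.card ι ≤ ∑ i, (N i).card

variable {M}

lemma DirectIn.card_add_four_le [Fintype A] [Fintype B] [DecidableEq A] [DecidableEq B]
    {E D : Finset (A × B)} (h : M.DirectIn E D) (hE : E ⊆ R)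
    (hn : 3 ≤ Fintype.card A + Fintype.card B) :
    D.card + 4 ≤ 2 * (Fintype.card A + Fintype.card B) := by
  obtain ⟨T, hT, hdisj, hconn, htouch⟩ := h
  refine card_add_four_le_of_grid_minor (fun v => M.vert v ∪ T v)
    (fun v => (M.vert_finite v).union ((M.territory_finite hE).subset (hT v))) hconn ?_ D htouch hn
  rintro v w p (h1 | h1) (h2 | h2)
  · exact M.vert_disjoint v w p h1 h2
  · exact absurd h1 (M.territory_vert hE (hT w h2) v)
  · exact absurd h2 (M.territory_vert hE (hT v h1) w)
  · exact hdisj v w p h1 h2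

lemma ClusterIn.add_four_le [Fintype A] [Fintype B] {E : Finset (A × B)} {g : ℕ}
    (h : M.ClusterIn E g) (hE : E ⊆ R) (hn : 3 ≤ Fintype.card A + Fintype.card B) :
    g + 4 ≤ 2 * (Fintype.card A + Fintype.card B) := by
  classical
  obtain ⟨ι, _, C, N, hC, hdisj, hconn, htouch, hg⟩ := h
  have key := card_add_four_le_of_grid_minor (X := A ⊕ B) (Y := ι) (Sum.elim M.vert C)
    (by
      rintro (v | i)
      · exact M.vert_finite v
      · exact (M.territory_finite hE).subset (hC i))
    (by
      rintro (v | i)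
      · exact M.vert_connected v
      · exact hconn i)
    (by
      rintro (v | i) (w | j) p h1 h2
      · rw [M.vert_disjoint v w p h1 h2]
      · exact absurd h1 (M.territory_vert hE (hC j h2) v)
      · exact absurd h2 (M.territory_vert hE (hC i h1) w)
      · rw [hdisj i j p h1 h2])
    (Finset.univ.filter fun q : (A ⊕ B) × ι => q.1 ∈ N q.2)
    (by
      rintro ⟨v, i⟩ h
      exact htouch i v (Finset.mem_filter.mp h).2)
    (by rw [Fintype.card_sum]; omega)
  have hcard : (Finset.univ.filter fun q : (A ⊕ B) × ι => q.1 ∈ N q.2).card =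
      ∑ i, (N i).card := by
    rw [Finset.card_eq_sum_card_fiberwise (f := Prod.snd) (t := Finset.univ) (by simp)]
    refine Finset.sum_congr rfl fun i _ => ?_
    refine Finset.card_bij' (fun q _ => q.1) (fun v _ => (v, i)) ?_ ?_ ?_ ?_
    · rintro ⟨v, j⟩ h
      simp only [Finset.mem_filter, Finset.mem_univ, true_and] at h
      exact h.2 ▸ h.1
    · intro v h
      simpa using h
    · rintro ⟨v, j⟩ h
      simp only [Finset.mem_filter, Finset.mem_univ, true_and] at h
      rw [h.2]
    · intros
      rfl
  rw [hcard, Fintype.card_sum] at key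
  omega

lemma DirectIn.mono {E F D : Finset (A × B)} (h : M.DirectIn E D) (hEF : E ⊆ F) :
    M.DirectIn F D := by
  obtain ⟨T, hT, h⟩ := h
  exact ⟨T, fun v => (hT v).trans (M.territory_mono hEF), h⟩

lemma ClusterIn.mono {E F : Finset (A × B)} {g : ℕ} (h : M.ClusterIn E g) (hEF : E ⊆ F) :
    M.ClusterIn F g := by
  obtain ⟨ι, _, C, N, hC, h⟩ := h
  exact ⟨ι, _, C, N, fun i => (hC i).trans (M.territory_mono hEF), h⟩

lemma territory_disjoint {E F : Finset (A × B)} (hEF : ∀ e ∈ E, ∀ f ∈ F, e ≠ f ∧ ¬ M.Cross e f)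
    {p : ℤ × ℤ} (hE : p ∈ M.territory E) (hF : p ∈ M.territory F) : False := by
  obtain ⟨e, he, hpe⟩ := M.mem_territory.mp hE
  obtain ⟨f, hf, hpf⟩ := M.mem_territory.mp hF
  obtain ⟨h1, h2⟩ := hEF e he f hf
  exact h2 ⟨h1, p, hpe, hpf⟩

lemma DirectIn.union [DecidableEq A] [DecidableEq B] {E₁ E₂ D₁ D₂ : Finset (A × B)}
    (h₁ : M.DirectIn E₁ D₁) (h₂ : M.DirectIn E₂ D₂)
    (hE : ∀ e ∈ E₁, ∀ f ∈ E₂, e ≠ f ∧ ¬ M.Cross e f) : M.DirectIn (E₁ ∪ E₂) (D₁ ∪ D₂) := by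
  obtain ⟨T₁, hT₁, hd₁, hc₁, ht₁⟩ := h₁
  obtain ⟨T₂, hT₂, hd₂, hc₂, ht₂⟩ := h₂
  have hsub₁ (v : A ⊕ B) : M.vert v ∪ T₁ v ⊆ M.vert v ∪ (T₁ v ∪ T₂ v) :=
    Set.union_subset_union_right _ Set.subset_union_left
  have hsub₂ (v : A ⊕ B) : M.vert v ∪ T₂ v ⊆ M.vert v ∪ (T₁ v ∪ T₂ v) :=
    Set.union_subset_union_right _ Set.subset_union_right
  refine ⟨fun v => T₁ v ∪ T₂ v, fun v => Set.union_subset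
    ((hT₁ v).trans (M.territory_mono Finset.subset_union_left))
    ((hT₂ v).trans (M.territory_mono Finset.subset_union_right)), ?_, fun v => ?_, ?_⟩
  · rintro v w p (h1 | h1) (h2 | h2)
    · exact hd₁ v w p h1 h2
    · exact (territory_disjoint hE (hT₁ v h1) (hT₂ w h2)).elim
    · exact (territory_disjoint hE (hT₁ w h2) (hT₂ v h1)).elim
    · exact hd₂ v w p h1 h2
  · obtain ⟨⟨p, hp⟩⟩ := (M.vert_connected v).nonempty
    have := (hc₁ v).union_of_inter (hc₂ v) ⟨p, Or.inl hp, Or.inl hp⟩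
    rwa [← Set.union_union_distrib_left] at this
  · intro e he
    rcases Finset.mem_union.mp he with h | h
    · exact (ht₁ e h).mono (hsub₁ _) (hsub₁ _)
    · exact (ht₂ e h).mono (hsub₂ _) (hsub₂ _)

lemma ClusterIn.union [DecidableEq A] [DecidableEq B] {E₁ E₂ : Finset (A × B)} {g₁ g₂ : ℕ}
    (h₁ : M.ClusterIn E₁ g₁) (h₂ : M.ClusterIn E₂ g₂)
    (hE : ∀ e ∈ E₁, ∀ f ∈ E₂, e ≠ f ∧ ¬ M.Cross e f) : M.ClusterIn (E₁ ∪ E₂) (g₁ + g₂) := by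
  obtain ⟨ι, _, C, N, hC, hd₁, hc₁, ht₁, hg₁⟩ := h₁
  obtain ⟨κ, _, C', N', hC', hd₂, hc₂, ht₂, hg₂⟩ := h₂
  refine ⟨ι ⊕ κ, inferInstance, Sum.elim C C', Sum.elim N N', ?_, ?_, ?_, ?_, ?_⟩
  · rintro (i | i)
    · exact (hC i).trans (M.territory_mono Finset.subset_union_left)
    · exact (hC' i).trans (M.territory_mono Finset.subset_union_right)
  · rintro (i | i) (j | j) p h1 h2
    · rw [hd₁ i j p h1 h2]
    · exact (territory_disjoint hE (hC i h1) (hC' j h2)).elim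
    · exact (territory_disjoint hE (hC j h2) (hC' i h1)).elim
    · rw [hd₂ i j p h1 h2]
  · rintro (i | i)
    exacts [hc₁ i, hc₂ i]
  · rintro (i | i)
    exacts [ht₁ i, ht₂ i]
  · simp only [Fintype.card_sum, Fintype.sum_sum_type, Sum.elim_inl, Sum.elim_inr]
    omega

lemma directIn_empty (E : Finset (A × B)) : M.DirectIn E ∅ :=
  ⟨fun _ => ∅, by simp, by simp, by simpa using M.vert_connected, by simp⟩

lemma clusterIn_zero (E : Finset (A × B)) : M.ClusterIn E 0 :=
  ⟨Empty, inferInstance, fun _ => ∅, fun _ => ∅, by simp, by simp, by simp, by simp, by simp⟩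

/-- Contracting a connected set onto the vertex `v` realises edges at `v`. -/
lemma directIn_of_contract {E D : Finset (A × B)} (v : A ⊕ B) {J : Set (ℤ × ℤ)}
    (hJ : GridConnected J) (hJE : J ⊆ M.territory E) (hv : Touches J (M.vert v))
    (hD : ∀ e ∈ D, (v = Sum.inl e.1 ∧ Touches J (M.vert (Sum.inr e.2))) ∨
      (v = Sum.inr e.2 ∧ Touches J (M.vert (Sum.inl e.1)))) : M.DirectIn E D := by
  classical
  refine ⟨fun w => if w = v then J else ∅, fun w => ?_, fun u w p => ?_, fun w => ?_,
    fun e he => ?_⟩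
  · by_cases h : w = v <;> simp [h, hJE]
  · by_cases h : u = v <;> by_cases h' : w = v <;> simp [h, h']
  · by_cases h : w = v
    · subst h
      simpa using (M.vert_connected w).union_of_touches hJ hv.symm
    · simpa [h] using M.vert_connected w
  · rcases hD e he with ⟨rfl, h⟩ | ⟨rfl, h⟩
    · exact h.mono (by simp) Set.subset_union_left
    · exact h.symm.mono Set.subset_union_left (by simp)

lemma directIn_singleton {e : A × B} (he : e ∈ R) : M.DirectIn {e} {e} :=
  directIn_of_contract (Sum.inl e.1) (M.edge_connected e he)
    (M.edge_subset_territory (Finset.mem_singleton_self e)) (M.touches_left e he) (by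
      intro f hf
      rw [Finset.mem_singleton.mp hf]
      exact Or.inl ⟨rfl, M.touches_right e he⟩)

lemma territory_singleton (e : A × B) : M.territory {e} = M.edge e := by
  ext p
  simp [mem_territory]

lemma territory_connected_singleton {e : A × B} (he : e ∈ R) :
    GridConnected (M.territory {e}) := by
  rw [territory_singleton]
  exact M.edge_connected e he

/-- Edges meeting in the connected territory of `E` can be contracted onto a common vertex. -/
lemma directIn_of_common_vertex {E D : Finset (A × B)} (v : A ⊕ B) (hE : E ⊆ R)
    (hconn : GridConnected (M.territory E))
    (hv : ∃ e ∈ E, v = Sum.inl e.1 ∨ v = Sum.inr e.2)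
    (hD : ∀ e ∈ D, (v = Sum.inl e.1 ∧ ∃ f ∈ E, e.2 = f.2) ∨
      (v = Sum.inr e.2 ∧ ∃ f ∈ E, e.1 = f.1)) : M.DirectIn E D := by
  refine directIn_of_contract v hconn subset_rfl ?_ fun e he => ?_
  · obtain ⟨e, he, rfl | rfl⟩ := hv
    · exact (M.touches_left e (hE he)).mono (M.edge_subset_territory he) subset_rfl
    · exact (M.touches_right e (hE he)).mono (M.edge_subset_territory he) subset_rfl
  · rcases hD e he with ⟨h, f, hf, h'⟩ | ⟨h, f, hf, h'⟩
    · refine Or.inl ⟨h, ?_⟩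
      rw [h']
      exact (M.touches_right f (hE hf)).mono (M.edge_subset_territory hf) subset_rfl
    · refine Or.inr ⟨h, ?_⟩
      rw [h']
      exact (M.touches_left f (hE hf)).mono (M.edge_subset_territory hf) subset_rfl

section

variable [DecidableEq A] [DecidableEq B]

lemma directIn_pair {e f : A × B} (he : e ∈ R) (hf : f ∈ R) (hef : e ≠ f)
    (h : ¬ M.Cross e f) : M.DirectIn {e, f} {e, f} := by
  have := (directIn_singleton he).union (directIn_singleton hf) (by simpa using ⟨hef, h⟩)
  rwa [← Finset.insert_eq] at this

lemma territory_insert (e : A × B) (E : Finset (A × B)) :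
    M.territory (insert e E) = M.edge e ∪ M.territory E := by
  ext p
  simp [mem_territory]

lemma territory_connected_insert {e f : A × B} {E : Finset (A × B)} (he : e ∈ R) (hf : f ∈ E)
    (hef : M.Cross e f) (hE : GridConnected (M.territory E)) :
    GridConnected (M.territory (insert e E)) := by
  rw [territory_insert]
  exact (M.edge_connected e he).union_of_inter hE
    (hef.2.mono (Set.inter_subset_inter_right _ (M.edge_subset_territory hf)))

lemma clusterIn_of_connected {E : Finset (A × B)} {g : ℕ} (hE : E ⊆ R)
    (hconn : GridConnected (M.territory E))
    (hg : g + 2 ≤ (E.image Prod.fst).card + (E.image Prod.snd).card) : M.ClusterIn E g := by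
  refine ⟨Unit, inferInstance, fun _ => M.territory E,
    fun _ => (E.image Prod.fst).disjSum (E.image Prod.snd), fun _ => subset_rfl, by simp,
    fun _ => hconn, fun _ v hv => ?_, by simpa using hg⟩
  rcases v with a | b
  · obtain ⟨e, he, rfl⟩ := Finset.mem_image.mp (Finset.inl_mem_disjSum.mp hv)
    exact ((M.touches_left e (hE he)).mono (M.edge_subset_territory he) subset_rfl).symm
  · obtain ⟨e, he, rfl⟩ := Finset.mem_image.mp (Finset.inr_mem_disjSum.mp hv)
    exact ((M.touches_right e (hE he)).mono (M.edge_subset_territory he) subset_rfl).symm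

end

end GridModel

end Models

section Counting

namespace GridModel

variable {A B : Type*} {R : Finset (A × B)}

open Classical in
/-- The edges of `E` crossing `e`. -/
noncomputable def crossing (M : GridModel A B R) (E : Finset (A × B)) (e : A × B) :
    Finset (A × B) := E.filter (M.Cross e)

open Classical in
/-- The number of ordered pairs of crossing edges of `E`. -/
noncomputable def crossPairs (M : GridModel A B R) (E : Finset (A × B)) : ℕ :=
  ((E ×ˢ E).filter fun q => M.Cross q.1 q.2).card

variable {M : GridModel A B R}

lemma mem_crossing {E : Finset (A × B)} {e f : A × B} :
    f ∈ M.crossing E e ↔ f ∈ E ∧ M.Cross e f := by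
  simp [crossing]

variable [DecidableEq A] [DecidableEq B]

lemma crossPairs_erase {E : Finset (A × B)} {e : A × B} (he : e ∈ E) :
    M.crossPairs (E.erase e) + 2 * (M.crossing E e).card ≤ M.crossPairs E := by
  classical
  have h1 : ((M.crossing E e).image fun f => (e, f)).card = (M.crossing E e).card :=
    Finset.card_image_of_injective _ fun _ _ h => (Prod.mk.inj h).2
  have h2 : ((M.crossing E e).image fun f => (f, e)).card = (M.crossing E e).card :=
    Finset.card_image_of_injective _ fun _ _ h => (Prod.mk.inj h).1
  have h3 : Disjoint ((M.crossing E e).image fun f => (e, f))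
      ((M.crossing E e).image fun f => (f, e)) := by
    rw [Finset.disjoint_left]
    rintro q hq hq'
    obtain ⟨f, hf, rfl⟩ := Finset.mem_image.mp hq
    obtain ⟨f', hf', h⟩ := Finset.mem_image.mp hq'
    exact (mem_crossing.mp hf').2.1 (Prod.mk.inj h).1.symm
  have h4 : Disjoint (((E.erase e) ×ˢ (E.erase e)).filter fun q => M.Cross q.1 q.2)
      (((M.crossing E e).image fun f => (e, f)) ∪ ((M.crossing E e).image fun f => (f, e))) := by
    rw [Finset.disjoint_left]
    rintro q hq hq'
    simp only [Finset.mem_filter, Finset.mem_product, Finset.mem_erase] at hq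
    rcases Finset.mem_union.mp hq' with h | h
    · obtain ⟨f, hf, rfl⟩ := Finset.mem_image.mp h
      exact hq.1.1.1 rfl
    · obtain ⟨f, hf, rfl⟩ := Finset.mem_image.mp h
      exact hq.1.2.1 rfl
  rw [two_mul]
  nth_rewrite 1 [← h1]
  rw [← h2, ← Finset.card_union_of_disjoint h3, crossPairs,
    ← Finset.card_union_of_disjoint h4, crossPairs]
  refine Finset.card_le_card fun q hq => ?_
  rw [Finset.mem_filter, Finset.mem_product]
  rcases Finset.mem_union.mp hq with h | h
  · simp only [Finset.mem_filter, Finset.mem_product, Finset.mem_erase] at h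
    exact ⟨⟨h.1.1.2, h.1.2.2⟩, h.2⟩
  · rcases Finset.mem_union.mp h with h | h
    · obtain ⟨f, hf, rfl⟩ := Finset.mem_image.mp h
      exact ⟨⟨he, (mem_crossing.mp hf).1⟩, (mem_crossing.mp hf).2⟩
    · obtain ⟨f, hf, rfl⟩ := Finset.mem_image.mp h
      exact ⟨⟨(mem_crossing.mp hf).1, he⟩, (mem_crossing.mp hf).2.symm⟩

/-- `W` consists of `k` edges of `E` whose deletion destroys at least `x` crossings. -/
def Removable (M : GridModel A B R) (E W : Finset (A × B)) (k x : ℕ) : Prop :=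
  W ⊆ E ∧ W.card = k ∧ M.crossPairs (E \ W) + 2 * x ≤ M.crossPairs E

lemma removable_empty (E : Finset (A × B)) : M.Removable E ∅ 0 0 := by
  simp [Removable]

lemma Removable.insert_of_le {E W : Finset (A × B)} {k x d : ℕ} (h : M.Removable E W k x)
    {e : A × B} (he : e ∈ E) (heW : e ∉ W) (hd : d ≤ (M.crossing (E \ W) e).card) :
    M.Removable E (insert e W) (k + 1) (x + d) := by
  obtain ⟨h1, h2, h3⟩ := h
  refine ⟨Finset.insert_subset he h1, by rw [Finset.card_insert_of_notMem heW, h2], ?_⟩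
  have := M.crossPairs_erase (Finset.mem_sdiff.mpr ⟨he, heW⟩)
  rw [Finset.sdiff_insert]
  omega

lemma Removable.insert_zero {E W : Finset (A × B)} {k x : ℕ} (h : M.Removable E W k x)
    {e : A × B} (he : e ∈ E) (heW : e ∉ W) : M.Removable E (insert e W) (k + 1) x :=
  h.insert_of_le he heW (Nat.zero_le _)

lemma Removable.insert_one {E W : Finset (A × B)} {k x : ℕ} (h : M.Removable E W k x)
    {e f : A × B} (he : e ∈ E) (heW : e ∉ W) (hf : f ∈ E) (hfW : f ∉ W) (hef : M.Cross e f) :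
    M.Removable E (insert e W) (k + 1) (x + 1) :=
  h.insert_of_le he heW (Finset.card_pos.mpr
    ⟨f, mem_crossing.mpr ⟨Finset.mem_sdiff.mpr ⟨hf, hfW⟩, hef⟩⟩)

lemma Removable.insert_two {E W : Finset (A × B)} {k x : ℕ} (h : M.Removable E W k x)
    {e f f' : A × B} (he : e ∈ E) (heW : e ∉ W) (hf : f ∈ E) (hfW : f ∉ W) (hf' : f' ∈ E)
    (hfW' : f' ∉ W) (hne : f ≠ f') (hef : M.Cross e f) (hef' : M.Cross e f') :
    M.Removable E (insert e W) (k + 1) (x + 2) :=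
  h.insert_of_le he heW (Finset.one_lt_card.mpr
    ⟨f, mem_crossing.mpr ⟨Finset.mem_sdiff.mpr ⟨hf, hfW⟩, hef⟩,
      f', mem_crossing.mpr ⟨Finset.mem_sdiff.mpr ⟨hf', hfW'⟩, hef'⟩, hne⟩)

/-- Directly realised edges, cluster gain and crossings together pay for the edges of `E`. -/
def Balanced (M : GridModel A B R) (E : Finset (A × B)) : Prop :=
  ∃ D ⊆ E, ∃ g, M.DirectIn E D ∧ M.ClusterIn E g ∧
    6 * E.card ≤ 6 * D.card + 2 * g + M.crossPairs E

lemma balanced_of_peel {E W K D : Finset (A × B)} {k x g : ℕ}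
    (ih : ∀ E' ⊆ E, E'.card < E.card → M.Balanced E') (hW : M.Removable E W k x) (hk : 0 < k)
    (hK : K ⊆ W) (hnc : ∀ e ∈ K, ∀ f ∈ E, f ∉ W → ¬ M.Cross e f) (hDK : D ⊆ K)
    (hD : M.DirectIn K D) (hg : M.ClusterIn K g) (h : 3 * k ≤ 3 * D.card + g + x) :
    M.Balanced E := by
  obtain ⟨hWE, hWk, hx⟩ := hW
  have hcard := Finset.card_sdiff_add_card_eq_card hWE
  obtain ⟨D', hD'E, g', hD', hg', h'⟩ := ih (E \ W) Finset.sdiff_subset (by omega)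
  have hsep : ∀ e ∈ K, ∀ f ∈ E \ W, e ≠ f ∧ ¬ M.Cross e f := by
    intro e he f hf
    rw [Finset.mem_sdiff] at hf
    exact ⟨fun h => hf.2 (h ▸ hK he), hnc e he f hf.1 hf.2⟩
  have hsub : K ∪ E \ W ⊆ E := Finset.union_subset (hK.trans hWE) Finset.sdiff_subset
  have hdisj : Disjoint D D' := by
    rw [Finset.disjoint_left]
    exact fun e he he' => (hsep e (hDK he) e (hD'E he')).1 rfl
  refine ⟨D ∪ D', Finset.union_subset ((hDK.trans hK).trans hWE)
    (hD'E.trans Finset.sdiff_subset), g + g', (hD.union hD' hsep).mono hsub,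
    (hg.union hg' hsep).mono hsub, ?_⟩
  rw [Finset.card_union_of_disjoint hdisj]
  omega

/-- In `E`, the edge `e` crosses `f` only. -/
def OneCrossing (M : GridModel A B R) (E : Finset (A × B)) (e f : A × B) : Prop :=
  f ∈ E ∧ M.Cross e f ∧ ∀ h ∈ E, M.Cross e h → h = f

/-- In `E`, the edge `e` crosses exactly the two edges `f` and `f'`. -/
def TwoCrossings (M : GridModel A B R) (E : Finset (A × B)) (e f f' : A × B) : Prop :=
  f ∈ E ∧ f' ∈ E ∧ f ≠ f' ∧ M.Cross e f ∧ M.Cross e f' ∧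
    ∀ h ∈ E, M.Cross e h → h = f ∨ h = f'

lemma oneCrossing_or_twoCrossings {E : Finset (A × B)} {e f : A × B}
    (hdeg : (M.crossing E e).card ≤ 2) (hf : f ∈ E) (hef : M.Cross e f) :
    M.OneCrossing E e f ∨ ∃ f', M.TwoCrossings E e f f' := by
  by_cases h : ∃ f' ∈ E, M.Cross e f' ∧ f' ≠ f
  · obtain ⟨f', hf', hef', hne⟩ := h
    refine Or.inr ⟨f', hf, hf', hne.symm, hef, hef', fun u hu heu => ?_⟩
    by_contra! hcon
    have : 2 < (M.crossing E e).card := Finset.two_lt_card.mpr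
      ⟨f, mem_crossing.mpr ⟨hf, hef⟩, f', mem_crossing.mpr ⟨hf', hef'⟩, u,
        mem_crossing.mpr ⟨hu, heu⟩, hne.symm, hcon.1.symm, hcon.2.symm⟩
    omega
  · push Not at h
    exact Or.inl ⟨hf, hef, h⟩

lemma card_le_card_image_mul (E : Finset (A × B)) :
    E.card ≤ (E.image Prod.fst).card * (E.image Prod.snd).card := by
  rw [← Finset.card_product]
  exact Finset.card_le_card Finset.subset_product

lemma two_le_card_image {α β : Type*} [DecidableEq β] {E : Finset α} {π : α → β} {e f : α}
    (he : e ∈ E) (hf : f ∈ E) (h : π e ≠ π f) : 2 ≤ (E.image π).card :=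
  Finset.one_lt_card.mpr ⟨_, Finset.mem_image_of_mem _ he, _, Finset.mem_image_of_mem _ hf, h⟩

lemma three_le_card_image {α β : Type*} [DecidableEq β] {E : Finset α} {π : α → β} {d e f : α}
    (hd : d ∈ E) (he : e ∈ E) (hf : f ∈ E) (hde : π d ≠ π e) (hdf : π d ≠ π f)
    (hef : π e ≠ π f) : 3 ≤ (E.image π).card :=
  Finset.two_lt_card.mpr ⟨_, Finset.mem_image_of_mem _ hd, _, Finset.mem_image_of_mem _ he, _,
    Finset.mem_image_of_mem _ hf, hde, hdf, hef⟩

lemma three_le_span {E : Finset (A × B)} (h : 2 ≤ E.card) :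
    3 ≤ (E.image Prod.fst).card + (E.image Prod.snd).card := by
  have := card_le_card_image_mul E
  by_contra! hcon
  have h1 : (E.image Prod.fst).card ≤ 2 := by omega
  interval_cases (E.image Prod.fst).card <;> omega

lemma four_le_span {E : Finset (A × B)} (h : 3 ≤ E.card) :
    4 ≤ (E.image Prod.fst).card + (E.image Prod.snd).card := by
  have := card_le_card_image_mul E
  by_contra! hcon
  have h1 : (E.image Prod.fst).card ≤ 3 := by omega
  interval_cases (E.image Prod.fst).card <;> omega

lemma five_le_span {E : Finset (A × B)} {d e f : A × B} (hd : d ∈ E) (he : e ∈ E) (hf : f ∈ E)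
    (hde : d.1 ≠ e.1 ∧ d.2 ≠ e.2) (hef : e.1 ≠ f.1 ∧ e.2 ≠ f.2) (hdf : d ≠ f) :
    5 ≤ (E.image Prod.fst).card + (E.image Prod.snd).card := by
  have h1 := two_le_card_image hd he hde.1
  have h2 := two_le_card_image hd he hde.2
  by_cases h : d.1 = f.1
  · have := three_le_card_image hd he hf hde.2 (fun h' => hdf (Prod.ext h h')) hef.2
    omega
  · have := three_le_card_image hd he hf hde.1 h hef.1
    omega

/-- A map which is injective on consecutive elements of a 5-cycle takes three values. -/
lemma three_le_card_image_of_pentagon {α β : Type*} [DecidableEq β] {E : Finset α} {π : α → β}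
    {a b c d e : α} (ha : a ∈ E) (hb : b ∈ E) (hc : c ∈ E) (hd : d ∈ E) (he : e ∈ E)
    (hab : π a ≠ π b) (hbc : π b ≠ π c) (hcd : π c ≠ π d) (hde : π d ≠ π e) (hea : π e ≠ π a) :
    3 ≤ (E.image π).card := by
  by_cases h : π a = π c
  · by_cases h' : π b = π d
    · exact three_le_card_image ha hb he hab hea.symm (h' ▸ hde)
    · exact three_le_card_image ha hb hd hab (h ▸ hcd) h'
  · exact three_le_card_image ha hb hc hab h hbc

lemma territory_connected_pair {e f : A × B} (he : e ∈ R) (hf : f ∈ R) (hef : M.Cross e f) :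
    GridConnected (M.territory {e, f}) :=
  territory_connected_insert he (Finset.mem_singleton_self f) hef (territory_connected_singleton hf)

lemma territory_connected_triple {d e f : A × B} (hd : d ∈ R) (he : e ∈ R) (hf : f ∈ R)
    (hde : M.Cross d e) (hef : M.Cross e f) : GridConnected (M.territory {d, e, f}) :=
  territory_connected_insert hd (Finset.mem_insert_self e {f}) hde
    (territory_connected_pair he hf hef)

lemma directIn_of_adjacent {e f : A × B} (he : e ∈ R) (hf : f ∈ R) (hef : M.Cross e f)
    (h : e.1 = f.1 ∨ e.2 = f.2) : M.DirectIn {e, f} {e, f} := by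
  have hsub : {e, f} ⊆ R := by simp [Finset.insert_subset_iff, he, hf]
  rcases h with h | h
  · refine directIn_of_common_vertex (Sum.inl e.1) hsub (territory_connected_pair he hf hef)
      ⟨e, by simp, Or.inl rfl⟩ ?_
    intro u hu
    rcases Finset.mem_insert.mp hu with rfl | hu
    · exact Or.inl ⟨rfl, u, by simp, rfl⟩
    · rw [Finset.mem_singleton] at hu
      subst hu
      exact Or.inl ⟨by rw [h], u, by simp, rfl⟩
  · refine directIn_of_common_vertex (Sum.inr e.2) hsub (territory_connected_pair he hf hef)
      ⟨e, by simp, Or.inr rfl⟩ ?_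
    intro u hu
    rcases Finset.mem_insert.mp hu with rfl | hu
    · exact Or.inr ⟨rfl, u, by simp, rfl⟩
    · rw [Finset.mem_singleton] at hu
      subst hu
      exact Or.inr ⟨by rw [h], u, by simp, rfl⟩

/-- Two disjoint crossing edges `e`, `f` also provide `e` together with an edge `u` joining an
end of `e` to an end of `f`. -/
lemma directIn_of_diagonal {e f u : A × B} (he : e ∈ R) (hf : f ∈ R) (hef : M.Cross e f)
    (hu1 : u.1 = e.1 ∨ u.1 = f.1) (hu2 : u.2 = e.2 ∨ u.2 = f.2) (hue : u ≠ e) (huf : u ≠ f) :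
    M.DirectIn {e, f} {e, u} := by
  have hsub : {e, f} ⊆ R := by simp [Finset.insert_subset_iff, he, hf]
  have key : (u.1 = e.1 ∧ u.2 = f.2) ∨ (u.1 = f.1 ∧ u.2 = e.2) := by
    rcases hu1 with h1 | h1 <;> rcases hu2 with h2 | h2
    · exact absurd (Prod.ext h1 h2) hue
    · exact Or.inl ⟨h1, h2⟩
    · exact Or.inr ⟨h1, h2⟩
    · exact absurd (Prod.ext h1 h2) huf
  rcases key with ⟨h1, h2⟩ | ⟨h1, h2⟩
  · refine directIn_of_common_vertex (Sum.inl e.1) hsub (territory_connected_pair he hf hef)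
      ⟨e, by simp, Or.inl rfl⟩ fun w hw => ?_
    simp only [Finset.mem_insert, Finset.mem_singleton] at hw
    rcases hw with rfl | rfl
    · exact Or.inl ⟨rfl, w, by simp, rfl⟩
    · exact Or.inl ⟨by rw [h1], f, by simp, h2⟩
  · refine directIn_of_common_vertex (Sum.inr e.2) hsub (territory_connected_pair he hf hef)
      ⟨e, by simp, Or.inr rfl⟩ fun w hw => ?_
    simp only [Finset.mem_insert, Finset.mem_singleton] at hw
    rcases hw with rfl | rfl
    · exact Or.inr ⟨rfl, w, by simp, rfl⟩
    · exact Or.inr ⟨by rw [h2], f, by simp, h1⟩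

lemma balanced_of_three_le {E : Finset (A × B)} {e : A × B}
    (ih : ∀ E' ⊆ E, E'.card < E.card → M.Balanced E') (he : e ∈ E)
    (h : 3 ≤ (M.crossing E e).card) : M.Balanced E :=
  balanced_of_peel ih ((removable_empty E).insert_of_le he (by simp) (d := 3) (by simpa using h))
    (by omega) (Finset.empty_subset _) (by simp) subset_rfl (directIn_empty ∅) (clusterIn_zero ∅)
    (by simp)

lemma balanced_of_isolated {E : Finset (A × B)} {e : A × B} (hE : E ⊆ R)
    (ih : ∀ E' ⊆ E, E'.card < E.card → M.Balanced E') (he : e ∈ E)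
    (h : ∀ f ∈ E, ¬ M.Cross e f) : M.Balanced E :=
  balanced_of_peel (K := {e}) ih ((removable_empty E).insert_zero he (by simp)) (by omega)
    (by simp) (fun e' he' f hf _ => by rw [Finset.mem_singleton.mp he']; exact h f hf)
    subset_rfl (directIn_singleton (hE he))
    (clusterIn_zero _) (by simp)

lemma balanced_of_pendant_adjacent {E : Finset (A × B)} {e₁ e₂ : A × B} (hE : E ⊆ R)
    (ih : ∀ E' ⊆ E, E'.card < E.card → M.Balanced E')
    (hdeg : ∀ e ∈ E, (M.crossing E e).card ≤ 2) (he₁ : e₁ ∈ E) (h : M.OneCrossing E e₁ e₂)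
    (hadj : e₁.1 = e₂.1 ∨ e₁.2 = e₂.2) : M.Balanced E := by
  obtain ⟨he₂, h12, h1⟩ := h
  have hne : e₁ ≠ e₂ := h12.1
  have hsub : {e₁, e₂} ⊆ R := by simp [Finset.insert_subset_iff, hE he₁, hE he₂]
  have hcl : M.ClusterIn {e₁, e₂} 1 := clusterIn_of_connected hsub
    (territory_connected_pair (hE he₁) (hE he₂) h12)
    (three_le_span (Finset.card_pair hne).ge)
  have hdir := directIn_of_adjacent (hE he₁) (hE he₂) h12 hadj
  rcases oneCrossing_or_twoCrossings (hdeg e₂ he₂) he₁ h12.symm with ⟨-, -, h2⟩ | ⟨f, h2⟩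
  · refine balanced_of_peel (K := {e₁, e₂}) ih
      (((removable_empty E).insert_one he₁ (by simp) he₂ (by simp) h12).insert_zero he₂
        (by simpa using hne.symm)) (by omega) (by grind) (by grind) subset_rfl hdir hcl ?_
    rw [Finset.card_pair hne]
    omega
  · obtain ⟨-, hf, hne', -, h2f, h2⟩ := h2
    have hne'' : e₂ ≠ f := h2f.1
    refine balanced_of_peel (K := {e₁, e₂}) ih
      ((((removable_empty E).insert_two he₂ (by simp) he₁ (by simp) hf (by simp) hne' h12.symm
        h2f).insert_zero he₁ (by simpa using hne)).insert_zero hf (by grind))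
        (by omega) (by grind) (by grind) subset_rfl hdir hcl ?_
    rw [Finset.card_pair hne]

lemma balanced_of_pendant {E : Finset (A × B)} {e₁ e₂ : A × B} (hE : E ⊆ R)
    (ih : ∀ E' ⊆ E, E'.card < E.card → M.Balanced E')
    (hdeg : ∀ e ∈ E, (M.crossing E e).card ≤ 2) (he₁ : e₁ ∈ E) (h : M.OneCrossing E e₁ e₂) :
    M.Balanced E := by
  by_cases hadj : e₁.1 = e₂.1 ∨ e₁.2 = e₂.2
  · exact balanced_of_pendant_adjacent hE ih hdeg he₁ h hadj
  push Not at hadj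
  obtain ⟨he₂, h12, h1⟩ := h
  have hne₁₂ : e₁ ≠ e₂ := h12.1
  rcases oneCrossing_or_twoCrossings (hdeg e₂ he₂) he₁ h12.symm with ⟨-, -, h2⟩ | ⟨e₃, h2⟩
  · have hsub : {e₁, e₂} ⊆ R := by simp [Finset.insert_subset_iff, hE he₁, hE he₂]
    have hcl : M.ClusterIn {e₁, e₂} 2 := clusterIn_of_connected hsub
      (territory_connected_pair (hE he₁) (hE he₂) h12)
      (Nat.add_le_add (two_le_card_image (by simp) (by simp) hadj.1)
        (two_le_card_image (by simp) (by simp) hadj.2))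
    exact balanced_of_peel (K := {e₁, e₂}) (D := {e₁}) ih
      (((removable_empty E).insert_one he₁ (by simp) he₂ (by simp) h12).insert_zero he₂
        (by simpa using hne₁₂.symm)) (by omega) (by grind) (by grind) (by simp)
      ((directIn_singleton (hE he₁)).mono (by simp)) hcl (by simp)
  obtain ⟨-, he₃, hne₁₃, -, h23, h2⟩ := h2
  have hne₂₃ : e₂ ≠ e₃ := h23.1
  have hn13 : ¬ M.Cross e₁ e₃ := fun h => hne₂₃ (h1 e₃ he₃ h).symm
  have hsub : {e₁, e₂, e₃} ⊆ R := by
    simp [Finset.insert_subset_iff, hE he₁, hE he₂, hE he₃]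
  have hconn : GridConnected (M.territory {e₁, e₂, e₃}) :=
    territory_connected_triple (hE he₁) (hE he₂) (hE he₃) h12 h23
  have hcl : M.ClusterIn {e₁, e₂, e₃} 2 := clusterIn_of_connected hsub hconn
    (four_le_span (Finset.card_eq_three.mpr ⟨_, _, _, hne₁₂, hne₁₃, hne₂₃, rfl⟩).ge)
  have hdir : M.DirectIn {e₁, e₂, e₃} {e₁, e₃} :=
    (directIn_pair (hE he₁) (hE he₃) hne₁₃ hn13).mono (by grind)
  have hr2 := (removable_empty E).insert_two he₂ (by simp) he₁ (by simp) he₃ (by simp) hne₁₃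
    h12.symm h23
  rcases oneCrossing_or_twoCrossings (hdeg e₃ he₃) he₂ h23.symm with ⟨-, -, h3⟩ | ⟨e₄, h3⟩
  · refine balanced_of_peel (K := {e₁, e₂, e₃}) (D := {e₁, e₃}) ih
      ((hr2.insert_zero he₁ (by simpa using hne₁₂)).insert_zero he₃ (by grind)) (by omega)
      (by grind) (by grind) (by grind) hdir hcl ?_
    rw [Finset.card_pair hne₁₃]
    omega
  obtain ⟨-, he₄, hne₂₄, -, h34, h3⟩ := h3
  have hne₃₄ : e₃ ≠ e₄ := h34.1
  have hne₁₄ : e₁ ≠ e₄ := by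
    rintro rfl
    exact hn13 h34.symm
  have hn24 : ¬ M.Cross e₂ e₄ := by grind
  have hn14 : ¬ M.Cross e₁ e₄ := by grind
  rcases oneCrossing_or_twoCrossings (hdeg e₄ he₄) he₃ h34.symm with ⟨-, -, h4⟩ | ⟨f, h4⟩
  · have hr : M.Removable E {e₃, e₁, e₄, e₂} 4 3 :=
      ((hr2.insert_one he₄ (by grind) he₃ (by grind) h34.symm).insert_zero he₁
        (by grind)).insert_zero he₃ (by grind)
    by_cases hin : (e₃.1 = e₁.1 ∨ e₃.1 = e₂.1) ∧ (e₃.2 = e₁.2 ∨ e₃.2 = e₂.2)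
    · have hd : M.DirectIn ({e₁, e₂} ∪ {e₄}) ({e₁, e₃} ∪ {e₄}) :=
        (directIn_of_diagonal (hE he₁) (hE he₂) h12 hin.1 hin.2 hne₁₃.symm hne₂₃.symm).union
          (directIn_singleton (hE he₄)) (by grind)
      refine balanced_of_peel (K := {e₁, e₂, e₃, e₄}) (D := {e₁, e₃} ∪ {e₄}) ih hr (by omega)
        (by grind) (by grind) (by grind) (hd.mono (by grind)) (clusterIn_zero _) ?_
      rw [Finset.card_union_of_disjoint (by simp [hne₁₄.symm, hne₃₄.symm]), Finset.card_pair hne₁₃]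
      simp
    · have hspan : 5 ≤ (({e₁, e₂, e₃} : Finset (A × B)).image Prod.fst).card +
          (({e₁, e₂, e₃} : Finset (A × B)).image Prod.snd).card := by
        have ha : 2 ≤ (({e₁, e₂, e₃} : Finset (A × B)).image Prod.fst).card :=
          two_le_card_image (e := e₁) (f := e₂) (by simp) (by simp) hadj.1
        have hb : 2 ≤ (({e₁, e₂, e₃} : Finset (A × B)).image Prod.snd).card :=
          two_le_card_image (e := e₁) (f := e₂) (by simp) (by simp) hadj.2
        rw [not_and_or, not_or, not_or] at hin
        rcases hin with hin | hin
        · have := three_le_card_image (E := {e₁, e₂, e₃}) (π := Prod.fst) (d := e₃) (e := e₁)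
            (f := e₂) (by simp) (by simp) (by simp) hin.1 hin.2 hadj.1
          omega
        · have := three_le_card_image (E := {e₁, e₂, e₃}) (π := Prod.snd) (d := e₃) (e := e₁)
            (f := e₂) (by simp) (by simp) (by simp) hin.1 hin.2 hadj.2
          omega
      refine balanced_of_peel (K := {e₁, e₂, e₃, e₄}) (D := {e₁, e₃}) ih hr (by omega)
        (by grind) (by grind) (by grind) (hdir.mono (by grind))
        ((clusterIn_of_connected (g := 3) hsub hconn hspan).mono (by grind)) ?_
      rw [Finset.card_pair hne₁₃]
  · obtain ⟨-, hf, hne₃f, -, h4f, h4⟩ := h4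
    have hne₂f : e₂ ≠ f := by
      rintro rfl
      exact hn24 h4f.symm
    refine balanced_of_peel (K := {e₁, e₂, e₃}) (D := {e₁, e₃}) ih
      (((hr2.insert_two he₄ (by grind) he₃ (by grind) hf (by grind) hne₃f h34.symm h4f).insert_zero
        he₁ (by grind)).insert_zero he₃ (by grind)) (by omega) (by grind) (by grind) (by grind)
        hdir hcl ?_
    rw [Finset.card_pair hne₁₃]

end GridModel

end Counting

section Cycles

namespace GridModel

variable {A B : Type*} {R : Finset (A × B)} {M : GridModel A B R}
variable [DecidableEq A] [DecidableEq B]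

lemma balanced_of_cycle_adjacent {E : Finset (A × B)} {e₁ e₂ : A × B} (hE : E ⊆ R)
    (ih : ∀ E' ⊆ E, E'.card < E.card → M.Balanced E')
    (hcyc : ∀ e ∈ E, ∀ f ∈ E, M.Cross e f → ∃ f', M.TwoCrossings E e f f')
    (he₁ : e₁ ∈ E) (he₂ : e₂ ∈ E) (h12 : M.Cross e₁ e₂) (hadj : e₁.1 = e₂.1 ∨ e₁.2 = e₂.2) :
    M.Balanced E := by
  obtain ⟨e₀, -, he₀, hne₂₀, -, h10, h1⟩ := hcyc e₁ he₁ e₂ he₂ h12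
  obtain ⟨e₃, -, he₃, hne₁₃, -, h23, h2⟩ := hcyc e₂ he₂ e₁ he₁ h12.symm
  have hne₁₂ : e₁ ≠ e₂ := h12.1
  have hne₁₀ : e₁ ≠ e₀ := h10.1
  have hne₂₃ : e₂ ≠ e₃ := h23.1
  have hsub : {e₁, e₂} ⊆ R := by simp [Finset.insert_subset_iff, hE he₁, hE he₂]
  have hcl : M.ClusterIn {e₁, e₂} 1 := clusterIn_of_connected hsub
    (territory_connected_pair (hE he₁) (hE he₂) h12) (three_le_span (Finset.card_pair hne₁₂).ge)
  have hdir := directIn_of_adjacent (hE he₁) (hE he₂) h12 hadj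
  have hr1 := (removable_empty E).insert_two he₁ (by simp) he₂ (by simp) he₀ (by simp) hne₂₀
    h12 h10
  by_cases h03 : e₀ = e₃
  · subst h03
    refine balanced_of_peel (K := {e₁, e₂}) ih
      ((hr1.insert_one he₂ (by simpa using hne₁₂.symm) he₀ (by simpa using hne₁₀.symm)
        h23).insert_zero he₀ (by simp [hne₂₀.symm, hne₁₀.symm])) (by omega) (by grind) (by grind)
      subset_rfl hdir hcl ?_
    rw [Finset.card_pair hne₁₂]
    omega
  by_cases hc : M.Cross e₀ e₃
  · have hn13 : ¬ M.Cross e₁ e₃ := by grind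
    obtain ⟨u, -, hu, hne₂u, -, h3u, h3⟩ := hcyc e₃ he₃ e₂ he₂ h23.symm
    have hu0 : e₀ = u := (h3 e₀ he₀ hc.symm).resolve_left hne₂₀.symm
    have hsub' : {e₁, e₂, e₃} ⊆ R := by
      simp [Finset.insert_subset_iff, hE he₁, hE he₂, hE he₃]
    have hcl' : M.ClusterIn {e₁, e₂, e₃} 2 := clusterIn_of_connected hsub'
      (territory_connected_triple (hE he₁) (hE he₂) (hE he₃) h12 h23)
      (four_le_span (Finset.card_eq_three.mpr ⟨_, _, _, hne₁₂, hne₁₃, hne₂₃, rfl⟩).ge)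
    refine balanced_of_peel (K := {e₁, e₂, e₃}) (D := {e₁, e₃}) ih
      (((hr1.insert_two he₃ (by simpa using hne₁₃.symm) he₂ (by simpa using hne₁₂.symm) he₀
        (by simpa using hne₁₀.symm) hne₂₀ h23.symm hc.symm).insert_zero he₂
        (by simp [hne₂₃, hne₁₂.symm])).insert_zero he₀ (by simp [h03, hne₂₀.symm, hne₁₀.symm]))
      (by omega) (by grind) (by grind) (by grind)
      ((directIn_pair (hE he₁) (hE he₃) hne₁₃ hn13).mono (by grind)) hcl' ?_
    rw [Finset.card_pair hne₁₃]
  · obtain ⟨u, -, hu, hne₁u, -, h0u, h0⟩ := hcyc e₀ he₀ e₁ he₁ h10.symm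
    obtain ⟨v, -, hv, hne₂v, -, h3v, h3⟩ := hcyc e₃ he₃ e₂ he₂ h23.symm
    have hv0 : v ≠ e₀ := by
      rintro rfl
      exact hc h3v.symm
    refine balanced_of_peel (K := {e₁, e₂}) ih
      (((((removable_empty E).insert_two he₀ (by simp) he₁ (by simp) hu (by simp) hne₁u h10.symm
        h0u).insert_two he₃ (by simpa using Ne.symm h03) he₂ (by simpa using hne₂₀) hv
        (by simpa using hv0) hne₂v h23.symm h3v).insert_one he₁ (by simp [hne₁₃, hne₁₀]) he₂
        (by simp [hne₂₃, hne₂₀]) h12).insert_zero he₂ (by simp [hne₁₂.symm, hne₂₃, hne₂₀]))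
      (by omega) (by grind) (by grind) subset_rfl hdir hcl ?_
    rw [Finset.card_pair hne₁₂]

lemma balanced_of_cycle_disjoint {E : Finset (A × B)} {e₁ e₀ : A × B} (hE : E ⊆ R)
    (ih : ∀ E' ⊆ E, E'.card < E.card → M.Balanced E')
    (hcyc : ∀ e ∈ E, ∀ f ∈ E, M.Cross e f → ∃ f', M.TwoCrossings E e f f')
    (hdis : ∀ e ∈ E, ∀ f ∈ E, M.Cross e f → e.1 ≠ f.1 ∧ e.2 ≠ f.2)
    (he₁ : e₁ ∈ E) (he₀ : e₀ ∈ E) (h10 : M.Cross e₁ e₀) : M.Balanced E := by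
  obtain ⟨e₂, -, he₂, hne₀₂, -, h12, h1⟩ := hcyc e₁ he₁ e₀ he₀ h10
  obtain ⟨f, -, hf, hne₁f, -, h0f, h0⟩ := hcyc e₀ he₀ e₁ he₁ h10.symm
  obtain ⟨f', -, hf', hne₁f', -, h2f', h2⟩ := hcyc e₂ he₂ e₁ he₁ h12.symm
  have hne₁₀ : e₁ ≠ e₀ := h10.1
  have hne₁₂ : e₁ ≠ e₂ := h12.1
  have hne₀f : e₀ ≠ f := h0f.1
  have hne₂f' : e₂ ≠ f' := h2f'.1
  have hsub : {e₀, e₁, e₂} ⊆ R := by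
    simp [Finset.insert_subset_iff, hE he₀, hE he₁, hE he₂]
  have hconn : GridConnected (M.territory {e₀, e₁, e₂}) :=
    territory_connected_triple (hE he₀) (hE he₁) (hE he₂) h10.symm h12
  have hcl : M.ClusterIn {e₀, e₁, e₂} 3 := clusterIn_of_connected hsub hconn
    (five_le_span (d := e₀) (e := e₁) (f := e₂) (by simp) (by simp) (by simp)
      (hdis _ he₀ _ he₁ h10.symm) (hdis _ he₁ _ he₂ h12) hne₀₂)
  have hr1 := (removable_empty E).insert_two he₁ (by simp) he₀ (by simp) he₂ (by simp) hne₀₂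
    h10 h12
  by_cases h02 : M.Cross e₀ e₂
  · have hf2 : e₂ = f := (h0 e₂ he₂ h02).resolve_left hne₁₂.symm
    have hf0 : e₀ = f' := (h2 e₀ he₀ h02.symm).resolve_left hne₁₀.symm
    exact balanced_of_peel (K := {e₀, e₁, e₂}) (D := {e₁}) ih
      ((hr1.insert_one he₀ (by simpa using hne₁₀.symm) he₂ (by simpa using hne₁₂.symm)
        h02).insert_zero he₂ (by simp [hne₀₂.symm, hne₁₂.symm])) (by omega) (by grind) (by grind)
      (by simp) ((directIn_singleton (hE he₁)).mono (by simp)) hcl (by simp)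
  have hfe₂ : f ≠ e₂ := by
    rintro rfl
    exact h02 h0f
  have hfe₀ : f' ≠ e₀ := by
    rintro rfl
    exact h02 h2f'.symm
  have hdir : M.DirectIn {e₀, e₁, e₂} {e₀, e₂} :=
    (directIn_pair (hE he₀) (hE he₂) hne₀₂ h02).mono (by grind)
  by_cases hff : f = f'
  · subst hff
    have hr : M.Removable E {e₂, e₀, f, e₁} 4 4 :=
      ((hr1.insert_two hf (by simpa using hne₁f.symm) he₀ (by simpa using hne₁₀.symm) he₂
        (by simpa using hne₁₂.symm) hne₀₂ h0f.symm h2f'.symm).insert_zero he₀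
        (by simp [hne₀f, hne₁₀.symm])).insert_zero he₂
        (by simp [hne₀₂.symm, hne₂f', hne₁₂.symm])
    refine balanced_of_peel (K := {e₀, e₁, e₂}) (D := {e₀, e₂}) ih hr (by omega) (by grind)
      (by grind) (by grind) hdir hcl ?_
    rw [Finset.card_pair hne₀₂]
    omega
  obtain ⟨u, -, hu, hne₀u, -, hfu, h3⟩ := hcyc f hf e₀ he₀ h0f.symm
  obtain ⟨v, -, hv, hne₂v, -, hfv, h4⟩ := hcyc f' hf' e₂ he₂ h2f'.symm
  by_cases hc : M.Cross f f'
  · have hu' : f' = u := (h3 f' hf' hc).resolve_left hfe₀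
    have hv' : f = v := (h4 f hf hc.symm).resolve_left hfe₂
    have hsub' : {f', f, e₀, e₁, e₂} ⊆ R := by
      simp [Finset.insert_subset_iff, hE he₀, hE he₁, hE he₂, hE hf, hE hf']
    have hconn' : GridConnected (M.territory {f', f, e₀, e₁, e₂}) :=
      territory_connected_insert (f := f) (hE hf') (by simp) hc.symm
        (territory_connected_insert (f := e₀) (hE hf) (by simp) h0f.symm hconn)
    have d1 := hdis _ hf' _ hf hc.symm
    have d2 := hdis _ hf _ he₀ h0f.symm
    have d3 := hdis _ he₀ _ he₁ h10.symm
    have d4 := hdis _ he₁ _ he₂ h12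
    have d5 := hdis _ he₂ _ hf' h2f'
    have hcl' : M.ClusterIn {f', f, e₀, e₁, e₂} 4 := clusterIn_of_connected hsub' hconn'
      (show 3 + 3 ≤ _ from Nat.add_le_add
        (three_le_card_image_of_pentagon (a := f') (b := f) (c := e₀) (d := e₁) (e := e₂)
          (by simp) (by simp) (by simp) (by simp) (by simp) d1.1 d2.1 d3.1 d4.1 d5.1)
        (three_le_card_image_of_pentagon (a := f') (b := f) (c := e₀) (d := e₁) (e := e₂)
          (by simp) (by simp) (by simp) (by simp) (by simp) d1.2 d2.2 d3.2 d4.2 d5.2))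
    have hr : M.Removable E {e₂, e₀, f', f, e₁} 5 5 :=
      (((hr1.insert_two hf (by simpa using hne₁f.symm) he₀ (by simpa using hne₁₀.symm) hf'
        (by simpa using hne₁f'.symm) hfe₀.symm h0f.symm hc).insert_one hf'
        (by simp [Ne.symm hff, hne₁f'.symm]) he₂ (by simp [hfe₂.symm, hne₁₂.symm])
        h2f'.symm).insert_zero he₀ (by simp [hfe₀.symm, hne₀f, hne₁₀.symm])).insert_zero he₂
        (by simp [hne₀₂.symm, hne₂f', hfe₂.symm, hne₁₂.symm])
    refine balanced_of_peel (K := {f', f, e₀, e₁, e₂}) (D := {e₀, e₂}) ih hr (by omega)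
      (by grind) (by grind) (by grind) (hdir.mono (by grind)) hcl' ?_
    rw [Finset.card_pair hne₀₂]
  · have hvf : v ≠ f := by
      rintro rfl
      exact hc hfv.symm
    have hv1 : v ≠ e₁ := by
      rintro rfl
      exact (h1 f' hf' hfv.symm).elim hfe₀ hne₂f'.symm
    have hu1 : u ≠ e₁ := by
      rintro rfl
      exact (h1 f hf hfu.symm).elim hne₀f.symm hfe₂
    have hr : M.Removable E {e₂, e₀, f', f, e₁} 5 6 :=
      (((hr1.insert_two hf (by simpa using hne₁f.symm) he₀ (by simpa using hne₁₀.symm) hu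
        (by simpa using hu1) hne₀u h0f.symm hfu).insert_two hf'
        (by simp [Ne.symm hff, hne₁f'.symm]) he₂ (by simp [hfe₂.symm, hne₁₂.symm]) hv
        (by simp [hvf, hv1]) hne₂v h2f'.symm hfv).insert_zero he₀
        (by simp [hfe₀.symm, hne₀f, hne₁₀.symm])).insert_zero he₂
        (by simp [hne₀₂.symm, hne₂f', hfe₂.symm, hne₁₂.symm])
    refine balanced_of_peel (K := {e₀, e₁, e₂}) (D := {e₀, e₂}) ih hr (by omega) (by grind)
      (by grind) (by grind) hdir hcl ?_
    rw [Finset.card_pair hne₀₂]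

lemma balanced_of_subset {E : Finset (A × B)} (hE : E ⊆ R) : M.Balanced E := by
  induction hn : E.card using Nat.strong_induction_on generalizing E with
  | _ n IH =>
    subst hn
    have ih : ∀ E' ⊆ E, E'.card < E.card → M.Balanced E' :=
      fun E' hE' h => IH _ h (hE'.trans hE) rfl
    by_cases h3 : ∃ e ∈ E, 3 ≤ (M.crossing E e).card
    · obtain ⟨e, he, h⟩ := h3
      exact balanced_of_three_le ih he h
    push Not at h3
    have hdeg : ∀ e ∈ E, (M.crossing E e).card ≤ 2 := fun e he => Nat.le_of_lt_succ (h3 e he)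
    by_cases h1 : ∃ e ∈ E, ∃ f, M.OneCrossing E e f
    · obtain ⟨e, he, f, h⟩ := h1
      exact balanced_of_pendant hE ih hdeg he h
    push Not at h1
    have hcyc : ∀ e ∈ E, ∀ f ∈ E, M.Cross e f → ∃ f', M.TwoCrossings E e f f' :=
      fun e he f hf hef =>
        (oneCrossing_or_twoCrossings (hdeg e he) hf hef).resolve_left (h1 e he f)
    obtain rfl | ⟨e, he⟩ := E.eq_empty_or_nonempty
    · exact ⟨∅, subset_rfl, 0, directIn_empty ∅, clusterIn_zero ∅, by simp⟩
    by_cases h0 : ∀ f ∈ E, ¬ M.Cross e f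
    · exact balanced_of_isolated hE ih he h0
    push Not at h0
    obtain ⟨f, hf, hef⟩ := h0
    by_cases hadj : ∃ e ∈ E, ∃ f ∈ E, M.Cross e f ∧ (e.1 = f.1 ∨ e.2 = f.2)
    · obtain ⟨e, he, f, hf, hef, h⟩ := hadj
      exact balanced_of_cycle_adjacent hE ih hcyc he hf hef h
    push Not at hadj
    exact balanced_of_cycle_disjoint hE ih hcyc hadj he hf hef

lemma card_le_crossPairs [Fintype A] [Fintype B] (M : GridModel A B R)
    (hn : 3 ≤ Fintype.card A + Fintype.card B) :
    6 * R.card + 32 ≤ 16 * (Fintype.card A + Fintype.card B) + M.crossPairs R := by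
  obtain ⟨D, -, g, hD, hg, h⟩ := balanced_of_subset (M := M) (subset_refl R)
  have h1 := hD.card_add_four_le subset_rfl hn
  have h2 := hg.add_four_le subset_rfl hn
  omega

end GridModel

end Cycles

section Discretisation

lemma gridGraph_adj_right (i j : ℤ) : gridGraph.Adj (i, j) (i + 1, j) :=
  ⟨(true, i, j), Or.inl ⟨rfl, rfl⟩⟩

lemma gridGraph_adj_up (i j : ℤ) : gridGraph.Adj (i, j) (i, j + 1) :=
  ⟨(false, i, j), Or.inl ⟨rfl, rfl⟩⟩

lemma gridConnected_prod {S T : Set ℤ} (hS : S.OrdConnected) (hT : T.OrdConnected)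
    (hSn : S.Nonempty) (hTn : T.Nonempty) : GridConnected (S ×ˢ T) := by
  have hrow : ∀ i i' j, ∀ hi : (i, j) ∈ S ×ˢ T, i ≤ i' → ∀ hi' : (i', j) ∈ S ×ˢ T,
      (gridGraph.induce (S ×ˢ T)).Reachable ⟨(i, j), hi⟩ ⟨(i', j), hi'⟩ := by
    intro i i' j hi hle
    induction i', hle using Int.leInduction with
    | base => exact fun _ => .rfl
    | succ n hn IH =>
      intro hi'
      have hmem : (n, j) ∈ S ×ˢ T := ⟨hS.out hi.1 hi'.1 ⟨hn, by simp⟩, hi.2⟩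
      exact (IH hmem).trans (Adj.reachable (by simpa using gridGraph_adj_right n j))
  have hcol : ∀ i j j', ∀ hj : (i, j) ∈ S ×ˢ T, j ≤ j' → ∀ hj' : (i, j') ∈ S ×ˢ T,
      (gridGraph.induce (S ×ˢ T)).Reachable ⟨(i, j), hj⟩ ⟨(i, j'), hj'⟩ := by
    intro i j j' hj hle
    induction j', hle using Int.leInduction with
    | base => exact fun _ => .rfl
    | succ n hn IH =>
      intro hj'
      have hmem : (i, n) ∈ S ×ˢ T := ⟨hj.1, hT.out hj.2 hj'.2 ⟨hn, by simp⟩⟩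
      exact (IH hmem).trans (Adj.reachable (by simpa using gridGraph_adj_up i n))
  obtain ⟨i₀, hi₀⟩ := hSn
  obtain ⟨j₀, hj₀⟩ := hTn
  rw [GridConnected, SimpleGraph.connected_iff]
  refine ⟨?_, ⟨⟨(i₀, j₀), hi₀, hj₀⟩⟩⟩
  rintro ⟨⟨i, j⟩, hi, hj⟩ ⟨⟨i', j'⟩, hi', hj'⟩
  have h1 : (gridGraph.induce (S ×ˢ T)).Reachable ⟨(i, j), hi, hj⟩ ⟨(i', j), hi', hj⟩ := by
    rcases le_total i i' with h | h
    · exact hrow i i' j ⟨hi, hj⟩ h ⟨hi', hj⟩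
    · exact (hrow i' i j ⟨hi', hj⟩ h ⟨hi, hj⟩).symm
  have h2 : (gridGraph.induce (S ×ˢ T)).Reachable ⟨(i', j), hi', hj⟩ ⟨(i', j'), hi', hj'⟩ := by
    rcases le_total j j' with h | h
    · exact hcol i' j j' ⟨hi', hj⟩ h ⟨hi', hj'⟩
    · exact (hcol i' j' j ⟨hi', hj'⟩ h ⟨hi', hj⟩).symm
  exact h1.trans h2

/-- The point of the plane represented by a grid point at mesh width `h`. -/
def gridPoint (h : ℝ) (p : ℤ × ℤ) : ℝ × ℝ := (h * p.1, h * p.2)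

/-- The grid point below and to the left of a point of the plane. -/
noncomputable def gridFloor (h : ℝ) (x : ℝ × ℝ) : ℤ × ℤ := (⌊x.1 / h⌋, ⌊x.2 / h⌋)

/-- The grid points within distance `r` of `x`. -/
def gridBall (h r : ℝ) (x : ℝ × ℝ) : Set (ℤ × ℤ) := {p | dist (gridPoint h p) x < r}

lemma mem_gridBall {h r : ℝ} {x : ℝ × ℝ} {p : ℤ × ℤ} :
    p ∈ gridBall h r x ↔ dist (gridPoint h p) x < r := Iff.rfl

lemma abs_mul_floor_sub_lt {h : ℝ} (hh : 0 < h) (x : ℝ) : |h * ⌊x / h⌋ - x| < h := by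
  have h1 := Int.floor_le (x / h)
  have h2 := Int.lt_floor_add_one (x / h)
  rw [le_div_iff₀ hh] at h1
  rw [div_lt_iff₀ hh] at h2
  rw [abs_sub_lt_iff]
  constructor <;> nlinarith

lemma gridFloor_mem_gridBall {h : ℝ} (hh : 0 < h) (x : ℝ × ℝ) :
    gridFloor h x ∈ gridBall h h x := by
  rw [mem_gridBall, Prod.dist_eq, max_lt_iff, Real.dist_eq, Real.dist_eq]
  exact ⟨abs_mul_floor_sub_lt hh x.1, abs_mul_floor_sub_lt hh x.2⟩

lemma gridBall_mono {h r s : ℝ} (hrs : r ≤ s) (x : ℝ × ℝ) : gridBall h r x ⊆ gridBall h s x :=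
  fun _ hp => lt_of_lt_of_le hp hrs

lemma dist_gridPoint_of_adj {h : ℝ} (hh : 0 < h) {p q : ℤ × ℤ} (hpq : gridGraph.Adj p q) :
    dist (gridPoint h p) (gridPoint h q) ≤ h := by
  have key (e : GridEdge) : dist (gridPoint h e.src) (gridPoint h e.tgt) ≤ h := by
    obtain ⟨b, i, j⟩ := e
    cases b <;> simp [gridPoint, GridEdge.src, GridEdge.tgt, Prod.dist_eq, mul_add,
      abs_of_pos hh, hh.le]
  obtain ⟨e, ⟨rfl, rfl⟩ | ⟨rfl, rfl⟩⟩ := hpq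
  · exact key e
  · rw [_root_.dist_comm]
    exact key e

/-- The integers `n` for which `h * n` is within distance `r` of `x`. -/
def intBall (h r x : ℝ) : Set ℤ := {n | |h * n - x| < r}

lemma gridBall_eq (h r : ℝ) (x : ℝ × ℝ) :
    gridBall h r x = intBall h r x.1 ×ˢ intBall h r x.2 := by
  ext p
  simp [mem_gridBall, Prod.dist_eq, Real.dist_eq, gridPoint, intBall]

lemma intBall_finite {h : ℝ} (hh : 0 < h) (r x : ℝ) : (intBall h r x).Finite := by
  refine (Set.finite_Icc ⌊(x - r) / h⌋ ⌈(x + r) / h⌉).subset fun n hn => ?_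
  obtain ⟨h1, h2⟩ := abs_sub_lt_iff.mp hn.out
  constructor
  · rw [← @Int.cast_le ℝ]
    exact (Int.floor_le _).trans ((div_le_iff₀ hh).mpr (by linarith))
  · rw [← @Int.cast_le ℝ]
    exact ((le_div_iff₀ hh).mpr (by linarith)).trans (Int.le_ceil _)

lemma intBall_ordConnected {h : ℝ} (hh : 0 < h) (r x : ℝ) : (intBall h r x).OrdConnected := by
  refine ⟨fun i hi j hj k hk => ?_⟩
  obtain ⟨-, h2⟩ := abs_sub_lt_iff.mp hi.out
  obtain ⟨h3, -⟩ := abs_sub_lt_iff.mp hj.out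
  have h4 : h * i ≤ h * k := mul_le_mul_of_nonneg_left (by exact_mod_cast hk.1) hh.le
  have h5 : h * k ≤ h * j := mul_le_mul_of_nonneg_left (by exact_mod_cast hk.2) hh.le
  rw [intBall, Set.mem_ofPred_eq, abs_sub_lt_iff]
  constructor <;> linarith

lemma gridBall_finite {h : ℝ} (hh : 0 < h) (r : ℝ) (x : ℝ × ℝ) : (gridBall h r x).Finite := by
  rw [gridBall_eq]
  exact (intBall_finite hh r x.1).prod (intBall_finite hh r x.2)

lemma gridBall_connected {h r : ℝ} (hh : 0 < h) (hr : h ≤ r) (x : ℝ × ℝ) :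
    GridConnected (gridBall h r x) := by
  have hmem := gridBall_mono hr x (gridFloor_mem_gridBall hh x)
  rw [gridBall_eq] at hmem ⊢
  exact gridConnected_prod (intBall_ordConnected hh r x.1) (intBall_ordConnected hh r x.2)
    ⟨_, hmem.1⟩ ⟨_, hmem.2⟩

lemma GridConnected.reachable_of_subset {S T : Set (ℤ × ℤ)} (hS : GridConnected S) (hST : S ⊆ T)
    {p q : ℤ × ℤ} (hp : p ∈ S) (hq : q ∈ S) :
    (gridGraph.induce T).Reachable ⟨p, hST hp⟩ ⟨q, hST hq⟩ :=
  (hS.preconnected ⟨p, hp⟩ ⟨q, hq⟩).map (SimpleGraph.induceHomOfLE _ hST).toHom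

/-- The grid points within distance `r` of a path. -/
def gridTube {x y : ℝ × ℝ} (h r : ℝ) (γ : Path x y) : Set (ℤ × ℤ) := ⋃ t, gridBall h r (γ t)

lemma gridBall_subset_gridTube {x y : ℝ × ℝ} (h r : ℝ) (γ : Path x y) (t : unitInterval) :
    gridBall h r (γ t) ⊆ gridTube h r γ := Set.subset_iUnion (fun t => gridBall h r (γ t)) t

lemma gridFloor_mem_gridTube {x y : ℝ × ℝ} {h : ℝ} (hh : 0 < h) (γ : Path x y)
    (t : unitInterval) : gridFloor h (γ t) ∈ gridTube h (2 * h) γ :=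
  gridBall_subset_gridTube h _ γ t
    (gridBall_mono (by linarith) _ (gridFloor_mem_gridBall hh _))

/-- A path yields a discrete walk close to it. -/
lemma reachable_gridTube {x y : ℝ × ℝ} {h : ℝ} (hh : 0 < h) (γ : Path x y)
    (s t : unitInterval) : (gridGraph.induce (gridTube h (2 * h) γ)).Reachable
      ⟨gridFloor h (γ s), gridFloor_mem_gridTube hh γ s⟩
      ⟨gridFloor h (γ t), gridFloor_mem_gridTube hh γ t⟩ := by
  let c : unitInterval → (gridGraph.induce (gridTube h (2 * h) γ)).ConnectedComponent :=
    fun t => (gridGraph.induce _).connectedComponentMk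
      ⟨gridFloor h (γ t), gridFloor_mem_gridTube hh γ t⟩
  have hc : IsLocallyConstant c := by
    rw [IsLocallyConstant.iff_eventually_eq]
    intro t
    filter_upwards [γ.continuous.continuousAt.eventually (Metric.ball_mem_nhds (γ t) hh)] with s hs
    refine SimpleGraph.ConnectedComponent.sound
      ((gridBall_connected hh (by linarith : h ≤ 2 * h) (γ t)).reachable_of_subset
        (gridBall_subset_gridTube h _ γ t) ?_
        (gridBall_mono (by linarith) _ (gridFloor_mem_gridBall hh _)))
    have h1 := mem_gridBall.mp (gridFloor_mem_gridBall hh (γ s))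
    have h2 := dist_triangle (gridPoint h (gridFloor h (γ s))) (γ s) (γ t)
    rw [mem_gridBall]
    linarith
  exact SimpleGraph.ConnectedComponent.exact (hc.apply_eq_of_preconnectedSpace s t)

lemma exists_connected_of_walk {Z P Q : Set (ℤ × ℤ)} (hPQ' : ¬ Touches P Q) {x y : Z}
    (w : (gridGraph.induce Z).Walk x y) (hy : y.1 ∈ Q) :
    (∃ I ⊆ Z, I.Finite ∧ GridConnected I ∧ (∀ z ∈ I, z ∉ P ∧ z ∉ Q) ∧ Touches I P ∧
      Touches I Q) ∨
    (∃ I ⊆ Z, I.Finite ∧ GridConnected I ∧ (∀ z ∈ I, z ∉ P ∧ z ∉ Q) ∧ x.1 ∈ I ∧ Touches I Q) ∨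
    x.1 ∈ Q := by
  induction w with
  | nil => exact Or.inr (Or.inr hy)
  | @cons x z y hxz w ih =>
    have hadj : gridGraph.Adj x.1 z.1 := hxz
    rcases ih hy with h | ⟨I, hIZ, hfin, hconn, hI, hz, hIQ⟩ | hz
    · exact Or.inl h
    · by_cases hxP : x.1 ∈ P
      · exact Or.inl ⟨I, hIZ, hfin, hconn, hI, ⟨z, hz, x, hxP, hadj.symm⟩, hIQ⟩
      by_cases hxQ : x.1 ∈ Q
      · exact Or.inr (Or.inr hxQ)
      refine Or.inr (Or.inl ⟨{x.1} ∪ I, Set.union_subset (by simp) hIZ,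
        (Set.finite_singleton _).union hfin,
        (gridConnected_singleton x.1).union_of_touches hconn ⟨x, rfl, z, hz, hadj⟩, ?_,
        Or.inl rfl, hIQ.mono Set.subset_union_right subset_rfl⟩)
      rintro u (rfl | hu)
      exacts [⟨hxP, hxQ⟩, hI u hu]
    · by_cases hxP : x.1 ∈ P
      · exact absurd ⟨x, hxP, z, hz, hadj⟩ hPQ'
      by_cases hxQ : x.1 ∈ Q
      · exact Or.inr (Or.inr hxQ)
      exact Or.inr (Or.inl ⟨{x.1}, by simp, Set.finite_singleton _, gridConnected_singleton x.1,
        by simp [hxP, hxQ], rfl, ⟨x, rfl, z, hz, hadj⟩⟩)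

/-- A discrete walk from `P` to `Q` contains a connected piece between `P` and `Q`. -/
lemma exists_connected_between {Z P Q : Set (ℤ × ℤ)} (hPQ : ∀ z ∈ P, z ∉ Q)
    (hPQ' : ¬ Touches P Q) {x y : Z} (hxy : (gridGraph.induce Z).Reachable x y) (hx : x.1 ∈ P)
    (hy : y.1 ∈ Q) : ∃ I ⊆ Z, I.Finite ∧ GridConnected I ∧ (∀ z ∈ I, z ∉ P ∧ z ∉ Q) ∧
      Touches I P ∧ Touches I Q := by
  obtain ⟨w⟩ := hxy
  rcases exists_connected_of_walk hPQ' w hy with h | ⟨I, -, -, -, hI, hxI, -⟩ | h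
  · exact h
  · exact absurd hx (hI _ hxI).1
  · exact absurd h (hPQ _ hx)

end Discretisation

section DrawingModel

open Filter Topology

lemma eventually_four_mul_le_dist {s t : Set (ℝ × ℝ)} (hs : IsCompact s) (ht : IsClosed t)
    (hst : Disjoint s t) : ∀ᶠ δ : ℝ in 𝓝[>] 0, ∀ x ∈ s, ∀ y ∈ t, 4 * δ ≤ dist x y := by
  obtain ⟨r, hr, h⟩ := Metric.exists_pos_forall_lt_edist hs ht hst
  have hr' : (0 : ℝ) < r / 4 := by positivity
  filter_upwards [Ioo_mem_nhdsGT hr'] with δ hδ x hx y hy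
  have h1 := h x hx y hy
  rw [edist_nndist, ENNReal.coe_lt_coe, ← NNReal.coe_lt_coe, coe_nndist] at h1
  linarith [hδ.2]

namespace Drawing

variable {V : Type*} {G : SimpleGraph V} (D : Drawing G)

/-- The part of an edge at distance at least `r` from its endpoints. -/
def core (r : ℝ) {u v : V} (h : G.Adj u v) : Set (ℝ × ℝ) :=
  Set.range (D.arc h) ∩ ({x | r ≤ dist x (D.pos u)} ∩ {x | r ≤ dist x (D.pos v)})

lemma core_isCompact (r : ℝ) {u v : V} (h : G.Adj u v) : IsCompact (D.core r h) :=
  (isCompact_range (D.arc h).continuous).inter_right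
    ((isClosed_le continuous_const (continuous_id.dist continuous_const)).inter
      (isClosed_le continuous_const (continuous_id.dist continuous_const)))

lemma core_subset_edgeInterior {r : ℝ} (hr : 0 < r) {u v : V} (h : G.Adj u v) :
    D.core r h ⊆ D.edgeInterior s(u, v) := by
  rintro _ ⟨⟨t, rfl⟩, hu, hv⟩
  simp only [edgeInterior, Set.mem_iUnion]
  refine ⟨u, v, h, rfl, t, ⟨?_, ?_⟩, rfl⟩
  · rintro rfl
    simp only [Path.source, _root_.dist_self, Set.mem_ofPred_eq] at hu
    linarith
  · rintro rfl
    simp only [Path.target, _root_.dist_self, Set.mem_ofPred_eq] at hv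
    linarith

lemma eventually_four_mul_le_dist_pos [Finite V] :
    ∀ᶠ δ : ℝ in 𝓝[>] 0, ∀ u v, u ≠ v → 4 * δ ≤ dist (D.pos u) (D.pos v) := by
  simp only [eventually_all]
  intro u v huv
  filter_upwards [eventually_four_mul_le_dist isCompact_singleton isClosed_singleton
    (Set.disjoint_singleton.mpr (D.pos_inj.ne huv))] with δ hδ
  exact hδ _ rfl _ rfl

lemma eventually_four_mul_le_dist_arc [Finite V] :
    ∀ᶠ δ : ℝ in 𝓝[>] 0, ∀ u v, ∀ h : G.Adj u v, ∀ w, w ≠ u → w ≠ v → ∀ t,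
      4 * δ ≤ dist (D.pos w) (D.arc h t) := by
  refine eventually_all.mpr fun u => eventually_all.mpr fun v => eventually_all.mpr fun h =>
    eventually_all.mpr fun w => eventually_all.mpr fun hwu => eventually_all.mpr fun hwv => ?_
  filter_upwards [eventually_four_mul_le_dist isCompact_singleton
    (isCompact_range (D.arc h).continuous).isClosed (s := {D.pos w}) (by
      rw [Set.disjoint_singleton_left]
      rintro ⟨t, ht⟩
      rcases D.arc_avoid h w t ht with rfl | rfl
      · exact hwu (D.pos_inj (by rw [← ht, Path.source]))
      · exact hwv (D.pos_inj (by rw [← ht, Path.target])))] with δ hδ t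
  exact hδ _ rfl _ ⟨t, rfl⟩

lemma eventually_four_mul_le_dist_core [Finite V] {r : ℝ} (hr : 0 < r) :
    ∀ᶠ η : ℝ in 𝓝[>] 0, ∀ u v, ∀ h : G.Adj u v, ∀ u' v', ∀ h' : G.Adj u' v',
      s(u, v) ≠ s(u', v') → ¬ D.Crosses s(u, v) s(u', v') →
      ∀ x ∈ D.core r h, ∀ y ∈ D.core r h', 4 * η ≤ dist x y := by
  refine eventually_all.mpr fun u => eventually_all.mpr fun v => eventually_all.mpr fun h =>
    eventually_all.mpr fun u' => eventually_all.mpr fun v' => eventually_all.mpr fun h' =>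
    eventually_all.mpr fun hne => eventually_all.mpr fun hc => ?_
  refine eventually_four_mul_le_dist (D.core_isCompact r h) (D.core_isCompact r h').isClosed ?_
  rw [Set.disjoint_left]
  intro x hx hx'
  exact hc ⟨h, h', hne, x, D.core_subset_edgeInterior hr h hx,
    D.core_subset_edgeInterior hr h' hx'⟩

end Drawing

/-- Every drawing of a bipartite graph can be discretised without creating new crossings. -/
lemma Drawing.exists_gridModel {A B : Type*} [Finite A] [Finite B] {G : SimpleGraph (A ⊕ B)}
    (D : Drawing G) (R : Finset (A × B)) (hR : ∀ e ∈ R, G.Adj (Sum.inl e.1) (Sum.inr e.2)) :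
    ∃ M : GridModel A B R, ∀ e ∈ R, ∀ f ∈ R, M.Cross e f →
      D.Crosses s(Sum.inl e.1, Sum.inr e.2) s(Sum.inl f.1, Sum.inr f.2) := by
  classical
  obtain ⟨δ, ⟨hpos, harc⟩, hδ⟩ := ((D.eventually_four_mul_le_dist_pos.and
    D.eventually_four_mul_le_dist_arc).and self_mem_nhdsWithin).exists
  replace hδ : 0 < δ := hδ
  obtain ⟨h, hcore, hh, hhδ⟩ := ((D.eventually_four_mul_le_dist_core (half_pos hδ)).and
    (Ioo_mem_nhdsGT (show (0 : ℝ) < δ / 4 by positivity))).exists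
  have hvert : ∀ v w p, p ∈ gridBall h δ (D.pos v) → p ∈ gridBall h δ (D.pos w) → v = w := by
    intro v w p hv hw
    by_contra hne
    have h1 := hpos v w hne
    have h2 := dist_triangle_left (D.pos v) (D.pos w) (gridPoint h p)
    rw [mem_gridBall] at hv hw
    linarith
  have htouch : ∀ v w, v ≠ w → ¬ Touches (gridBall h δ (D.pos v)) (gridBall h δ (D.pos w)) := by
    rintro v w hne ⟨p, hp, q, hq, hpq⟩
    have h1 := hpos v w hne
    have h2 := dist_triangle4_right (D.pos v) (D.pos w) (gridPoint h p) (gridPoint h q)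
    have h3 := dist_gridPoint_of_adj hh hpq
    rw [mem_gridBall, _root_.dist_comm] at hp hq
    linarith
  have hfloor : ∀ v, gridFloor h (D.pos v) ∈ gridBall h δ (D.pos v) := fun v =>
    gridBall_mono (by linarith) _ (gridFloor_mem_gridBall hh _)
  have hedge : ∀ e ∈ R, ∃ I : Set (ℤ × ℤ), I.Finite ∧ GridConnected I ∧
      (∀ v, ∀ p ∈ I, p ∉ gridBall h δ (D.pos v)) ∧
      Touches I (gridBall h δ (D.pos (Sum.inl e.1))) ∧
      Touches I (gridBall h δ (D.pos (Sum.inr e.2))) ∧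
      ∀ he : G.Adj (Sum.inl e.1) (Sum.inr e.2), ∀ p ∈ I, ∃ x ∈ D.core (δ / 2) he,
        dist (gridPoint h p) x < 2 * h := by
    intro e he
    have hadj := hR e he
    have hne : (Sum.inl e.1 : A ⊕ B) ≠ Sum.inr e.2 := by simp
    obtain ⟨I, hIZ, hfin, hconn, hI, hl, hr⟩ := exists_connected_between
      (fun z hz hz' => hne (hvert _ _ z hz hz')) (htouch _ _ hne)
      (reachable_gridTube hh (D.arc hadj) 0 1) (by simpa using hfloor _) (by simpa using hfloor _)
    have hnear : ∀ p ∈ I, ∃ t, dist (gridPoint h p) (D.arc hadj t) < 2 * h := fun p hp => by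
      simpa [gridTube, mem_gridBall] using hIZ hp
    refine ⟨I, hfin, hconn, fun v p hp hpv => ?_, hl, hr, fun _ p hp => ?_⟩
    · by_cases h1 : v = Sum.inl e.1
      · exact (hI p hp).1 (h1 ▸ hpv)
      by_cases h2 : v = Sum.inr e.2
      · exact (hI p hp).2 (h2 ▸ hpv)
      obtain ⟨t, ht⟩ := hnear p hp
      have h3 := harc _ _ hadj v h1 h2 t
      have h4 := dist_triangle_left (D.pos v) (D.arc hadj t) (gridPoint h p)
      rw [mem_gridBall] at hpv
      linarith
    · obtain ⟨t, ht⟩ := hnear p hp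
      obtain ⟨h1, h2⟩ := hI p hp
      rw [mem_gridBall, not_lt] at h1 h2
      refine ⟨_, ⟨⟨t, rfl⟩, ?_, ?_⟩, ht⟩
      · rw [Set.mem_ofPred_eq]
        linarith [dist_triangle (gridPoint h p) (D.arc hadj t) (D.pos (Sum.inl e.1))]
      · rw [Set.mem_ofPred_eq]
        linarith [dist_triangle (gridPoint h p) (D.arc hadj t) (D.pos (Sum.inr e.2))]
  choose! I hfin hconn hdisj hl hr hI using hedge
  refine ⟨⟨fun v => gridBall h δ (D.pos v), I, fun v => gridBall_finite hh _ _,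
    fun v => gridBall_connected hh (by linarith) _, hvert, hfin, hconn,
    fun e he v p hp => hdisj e he v p hp, hl, hr⟩, ?_⟩
  rintro e he f hf ⟨hne, p, hpe, hpf⟩
  by_contra hcon
  obtain ⟨x, hx, hpx⟩ := hI e he (hR e he) p hpe
  obtain ⟨y, hy, hpy⟩ := hI f hf (hR f hf) p hpf
  have h1 := hcore _ _ (hR e he) _ _ (hR f hf) (fun h => hne (by
    simpa [Prod.ext_iff] using h)) hcon x hx y hy
  linarith [dist_triangle_left x y (gridPoint h p)]

end DrawingModel

section CrossingNumbers

/-- The straight-line drawing with vertices on a parabola. -/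
noncomputable def Drawing.parabola {V : Type*} (G : SimpleGraph V) {x : V → ℝ}
    (hx : Function.Injective x) : Drawing G where
  pos v := (x v, x v ^ 2)
  pos_inj _ _ h := hx (Prod.mk.inj h).1
  arc u v _ := Path.segment (x u, x u ^ 2) (x v, x v ^ 2)
  arc_symm _ _ _ := (Path.segment_symm _ _).symm
  arc_inj _ _ h := Path.segment_injective_of_ne fun h' => h.ne (hx (Prod.mk.inj h').1)
  arc_avoid u v h w t ht := by
    have hne : x u - x v ≠ 0 := sub_ne_zero.mpr (hx.ne h.ne)
    rw [Path.segment_apply, AffineMap.lineMap_apply_module] at ht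
    obtain ⟨h1, h2⟩ := Prod.ext_iff.mp ht
    simp only [Prod.fst_add, Prod.snd_add, Prod.smul_mk, smul_eq_mul] at h1 h2
    rw [← h1] at h2
    have h3 : (t : ℝ) * (1 - t) * (x u - x v) ^ 2 = 0 := by
      linear_combination h2
    rcases mul_eq_zero.mp h3 with h3 | h3
    · rcases mul_eq_zero.mp h3 with h3 | h3
      · exact Or.inl (Subtype.ext h3)
      · exact Or.inr (Subtype.ext (sub_eq_zero.mp h3).symm)
    · exact absurd (pow_eq_zero_iff two_ne_zero |>.mp h3) hne

lemma exists_drawing_crossCount_eq {V : Type*} [Countable V] (G : SimpleGraph V) :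
    ∃ D : Drawing G, D.crossCount = crossingNumber G := by
  obtain ⟨f, hf⟩ := exists_injective_nat V
  have hne : {n : ℕ | ∃ D : Drawing G, D.crossCount = n}.Nonempty :=
    ⟨_, Drawing.parabola G (x := fun v => (f v : ℝ)) (Nat.cast_injective.comp hf), rfl⟩
  exact Nat.sInf_mem hne

variable {A B : Type*}

lemma sym2_inl_inr_injective :
    Function.Injective fun e : A × B => s((Sum.inl e.1 : A ⊕ B), Sum.inr e.2) := by
  intro e f h
  simpa [Prod.ext_iff] using h

lemma Drawing.three_mul_card_le [Fintype A] [Fintype B] {G : SimpleGraph (A ⊕ B)} (D : Drawing G)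
    (R : Finset (A × B)) (hR : ∀ e ∈ R, G.Adj (Sum.inl e.1) (Sum.inr e.2))
    (hn : 3 ≤ Fintype.card A + Fintype.card B) :
    3 * R.card + 16 ≤ 8 * (Fintype.card A + Fintype.card B) + D.crossCount := by
  classical
  obtain ⟨M, hM⟩ := D.exists_gridModel R hR
  have h1 := M.card_le_crossPairs hn
  have h2 : M.crossPairs R ≤
      {p : Sym2 (A ⊕ B) × Sym2 (A ⊕ B) | D.Crosses p.1 p.2}.ncard := by
    have hinj := sym2_inl_inr_injective (A := A) (B := B)
    rw [GridModel.crossPairs, ← Finset.card_image_of_injective _ (hinj.prodMap hinj),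
      ← Set.ncard_coe_finset]
    refine Set.ncard_le_ncard ?_ (Set.toFinite _)
    rintro _ hp
    obtain ⟨q, hq, rfl⟩ := Finset.mem_image.mp (Finset.mem_coe.mp hp)
    rw [Finset.mem_filter, Finset.mem_product] at hq
    exact hM _ hq.1.1 _ hq.1.2 hq.2
  rw [Drawing.crossCount]
  omega

lemma three_mul_card_le_crossingNumber [Fintype A] [Fintype B] (G : SimpleGraph (A ⊕ B))
    (R : Finset (A × B)) (hR : ∀ e ∈ R, G.Adj (Sum.inl e.1) (Sum.inr e.2))
    (hn : 3 ≤ Fintype.card A + Fintype.card B) :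
    3 * R.card + 16 ≤ 8 * (Fintype.card A + Fintype.card B) + crossingNumber G := by
  obtain ⟨D, hD⟩ := exists_drawing_crossCount_eq G
  rw [← hD]
  exact D.three_mul_card_le R hR hn

lemma exists_eq_kCrossingNumber {V : Type*} (k : ℕ) [NeZero k] (G : SimpleGraph V) :
    ∃ f : Fin k → SimpleGraph V, (⨆ i, f i) = G ∧
      kCrossingNumber k G = ∑ i, crossingNumber (f i) := by
  have hne : {n : ℕ | ∃ f : Fin k → SimpleGraph V, (⨆ i, f i) = G ∧
      (∀ i j : Fin k, i ≠ j → Disjoint (f i).edgeSet (f j).edgeSet) ∧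
      n = ∑ i : Fin k, crossingNumber (f i)}.Nonempty := by
    refine ⟨_, fun i => if i = 0 then G else ⊥, ?_, ?_, rfl⟩
    · refine le_antisymm (iSup_le fun i => ?_) (le_iSup_of_le 0 (by simp))
      dsimp only
      split_ifs <;> simp
    · intro i j hij
      by_cases hi : i = 0
      · have hj : j ≠ 0 := hi ▸ hij.symm
        simp [hj]
      · simp [hi]
  obtain ⟨f, hf, -, h⟩ := Nat.sInf_mem hne
  exact ⟨f, hf, h⟩

/-- The biplanar crossing number of a complete bipartite graph, bounded by counting edges. -/
lemma three_mul_mul_le_kCrossingNumber (A B : Type*) [Fintype A] [Fintype B]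
    (hn : 3 ≤ Fintype.card A + Fintype.card B) :
    3 * (Fintype.card A * Fintype.card B) + 32 ≤ 16 * (Fintype.card A + Fintype.card B) +
      kCrossingNumber 2 (completeBipartiteGraph A B) := by
  classical
  obtain ⟨f, hf, h⟩ := exists_eq_kCrossingNumber 2 (completeBipartiteGraph A B)
  let R (i : Fin 2) : Finset (A × B) :=
    Finset.univ.filter fun e => (f i).Adj (Sum.inl e.1) (Sum.inr e.2)
  have hR (i : Fin 2) := three_mul_card_le_crossingNumber (f i) (R i)
    (fun e he => (Finset.mem_filter.mp he).2) hn
  have hcover : (Finset.univ : Finset (A × B)) ⊆ R 0 ∪ R 1 := by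
    intro e _
    have hadj : (⨆ i, f i).Adj (Sum.inl e.1) (Sum.inr e.2) := by
      rw [hf]
      simp
    rw [SimpleGraph.iSup_adj, Fin.exists_fin_two] at hadj
    simpa [R] using hadj
  have hcard := (Finset.card_le_card hcover).trans (Finset.card_union_le _ _)
  rw [Finset.card_univ, Fintype.card_prod] at hcard
  rw [Fin.sum_univ_two] at h
  have h0 := hR 0
  have h1 := hR 1
  omega

end CrossingNumbers

/-- `cr₂(K_{15,15}) ≥ 203`. -/
theorem cr2_K15_15_lower_bound :
    203 ≤ kCrossingNumber 2 (completeBipartiteGraph (Fin 15) (Fin 15)) := by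
  have h := three_mul_mul_le_kCrossingNumber (Fin 15) (Fin 15) (by simp)
  simp only [Fintype.card_fin] at h
  omega
end

section
/- Every simple graph G with crossing number cr(G) ≤ 4 is biplanar, i.e., cr_2(G) = 0. -/
open SimpleGraph

namespace Drawing

variable {V : Type*} {G H : SimpleGraph V}

theorem mem_edgeInterior {D : Drawing G} {e : Sym2 V} {p : ℝ × ℝ} :
    p ∈ D.edgeInterior e ↔ ∃ (u v : V) (h : G.Adj u v), e = s(u, v) ∧
      ∃ t : unitInterval, (t ≠ 0 ∧ t ≠ 1) ∧ D.arc h t = p := by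
  simp only [edgeInterior, Set.mem_iUnion, Set.mem_image, Set.mem_ofPred_eq, exists_prop]

theorem Crosses.symm {D : Drawing G} {e f : Sym2 V} (h : D.Crosses e f) : D.Crosses f e :=
  ⟨h.2.1, h.1, h.2.2.1.symm, by rw [Set.inter_comm]; exact h.2.2.2⟩

/-- The restriction of a drawing to a subgraph. -/
def restrict (D : Drawing G) (hle : H ≤ G) : Drawing H where
  pos := D.pos
  pos_inj := D.pos_inj
  arc _ _ h := D.arc (hle h)
  arc_symm _ _ h := D.arc_symm (hle h)
  arc_inj _ _ h := D.arc_inj (hle h)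
  arc_avoid _ _ h := D.arc_avoid (hle h)

theorem Crosses.of_restrict {D : Drawing G} {hle : H ≤ G} {e f : Sym2 V}
    (h : (D.restrict hle).Crosses e f) : D.Crosses e f := by
  obtain ⟨he, hf, hne, p, hpe, hpf⟩ := h
  refine ⟨SimpleGraph.edgeSet_mono hle he, SimpleGraph.edgeSet_mono hle hf, hne, p, ?_, ?_⟩
  · obtain ⟨u, v, h, r⟩ := mem_edgeInterior.1 hpe
    exact mem_edgeInterior.2 ⟨u, v, hle h, r⟩
  · obtain ⟨u, v, h, r⟩ := mem_edgeInterior.1 hpf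
    exact mem_edgeInterior.2 ⟨u, v, hle h, r⟩

theorem crossingNumber_eq_zero (D : Drawing G) (h : ∀ e f, ¬ D.Crosses e f) :
    crossingNumber G = 0 := by
  refine Nat.sInf_eq_zero.2 (Or.inl ⟨D, ?_⟩)
  simp [crossCount, h]

/-- The straight-line drawing with the vertices placed on the parabola `y = x ^ 2`. -/
def parabola_s13 (G : SimpleGraph V) (x : V → ℝ) (hx : Function.Injective x) : Drawing G where
  pos v := (x v, x v ^ 2)
  pos_inj u v h := hx (congrArg Prod.fst h)
  arc u v _ :=
    { toFun := fun t => (x u + t * (x v - x u), x u ^ 2 + t * (x v ^ 2 - x u ^ 2))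
      continuous_toFun := by fun_prop
      source' := by simp
      target' := by simp }
  arc_symm u v h := by
    ext t
    · simp [Path.symm]; ring
    · simp [Path.symm]; ring
  arc_inj u v h s t hst := by
    have hne : x v - x u ≠ 0 := sub_ne_zero.2 fun e => h.ne (hx e).symm
    have h1 : x u + s * (x v - x u) = x u + t * (x v - x u) := congrArg Prod.fst hst
    exact Subtype.ext (mul_right_cancel₀ hne (add_left_cancel h1))
  arc_avoid u v h w t ht := by
    have hne : x v - x u ≠ 0 := sub_ne_zero.2 fun e => h.ne (hx e).symm
    have h1 : x u + t * (x v - x u) = x w := congrArg Prod.fst ht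
    have h2 : x u ^ 2 + t * (x v ^ 2 - x u ^ 2) = x w ^ 2 := congrArg Prod.snd ht
    have h3 : ((t : ℝ) * (1 - t)) * (x v - x u) ^ 2 = 0 := by
      rw [← h1] at h2
      linear_combination h2
    rcases mul_eq_zero.1 ((mul_eq_zero.1 h3).resolve_right (pow_ne_zero 2 hne)) with h | h
    · exact Or.inl (Subtype.ext h)
    · exact Or.inr (Subtype.ext (sub_eq_zero.1 h).symm)

theorem exists_of_mem_edgeInterior_parabola {x : V → ℝ} {hx : Function.Injective x}
    {e : Sym2 V} {p : ℝ × ℝ} (hp : p ∈ (parabola_s13 G x hx).edgeInterior e) :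
    ∃ u v, G.Adj u v ∧ e = s(u, v) ∧ x u < p.1 ∧ p.1 < x v ∧
      p.2 - p.1 ^ 2 = (p.1 - x u) * (x v - p.1) := by
  obtain ⟨u, v, h, rfl, t, ⟨ht0, ht1⟩, rfl⟩ := mem_edgeInterior.1 hp
  have h0 : 0 < (t : ℝ) := unitInterval.pos_iff_ne_zero.2 ht0
  have h1 : 0 < 1 - (t : ℝ) := sub_pos.2 (unitInterval.lt_one_iff_ne_one.2 ht1)
  change ∃ a b, G.Adj a b ∧ s(u, v) = s(a, b) ∧ x a < x u + t * (x v - x u) ∧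
    x u + t * (x v - x u) < x b ∧ x u ^ 2 + t * (x v ^ 2 - x u ^ 2) - (x u + t * (x v - x u)) ^ 2
      = (x u + t * (x v - x u) - x a) * (x b - (x u + t * (x v - x u)))
  rcases lt_or_gt_of_ne (hx.ne h.ne) with huv | huv
  · exact ⟨u, v, h, rfl, by nlinarith, by nlinarith, by ring⟩
  · exact ⟨v, u, h.symm, Sym2.eq_swap, by nlinarith, by nlinarith, by ring⟩

theorem not_crosses_parabola {x : V → ℝ} {hx : Function.Injective x}
    (hG : ∀ u v w z, G.Adj u v → G.Adj w z → ¬ (x u < x w ∧ x w < x v ∧ x v < x z))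
    (e f : Sym2 V) : ¬ (parabola_s13 G x hx).Crosses e f := by
  rintro ⟨-, -, hne, p, hpe, hpf⟩
  obtain ⟨u, v, huv, rfl, hu, hv, h1⟩ := exists_of_mem_edgeInterior_parabola hpe
  obtain ⟨w, z, hwz, rfl, hw, hz, h2⟩ := exists_of_mem_edgeInterior_parabola hpf
  have n1 := hG u v w z huv hwz
  have n2 := hG w z u v hwz huv
  have key : (p.1 - x u) * (x v - p.1) = (p.1 - x w) * (x z - p.1) := h1 ▸ h2
  rcases lt_trichotomy (x u) (x w) with h | h | h
  · have : x z ≤ x v := not_lt.1 fun h' => n1 ⟨h, hw.trans hv, h'⟩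
    nlinarith
  · rcases lt_trichotomy (x v) (x z) with h' | h' | h'
    · nlinarith
    · exact hne (by rw [hx h, hx h'])
    · nlinarith
  · have : x v ≤ x z := not_lt.1 fun h' => n2 ⟨h, hu.trans hz, h'⟩
    nlinarith

end Drawing

/-- Every `ℕ`-valued key on a finite type is refined by an injective real-valued one. -/
theorem exists_injective_refining {V : Type*} [Finite V] (k : V → ℕ) :
    ∃ x : V → ℝ, Function.Injective x ∧ ∀ u v, x u < x v → k u ≤ k v := by
  obtain ⟨n, ⟨e⟩⟩ := Finite.exists_equiv_fin V
  have key : ∀ u v, k u < k v → k u * n + e u < k v * n + e v := by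
    intro u v h
    have := (e u).isLt
    nlinarith [Nat.zero_le (e v : ℕ)]
  refine ⟨fun v => ((k v * n + e v : ℕ) : ℝ), fun u v h => ?_, fun u v h => ?_⟩
  · have h' : k u * n + e u = k v * n + e v := Nat.cast_injective h
    rcases lt_trichotomy (k u) (k v) with hk | hk | hk
    · exact absurd h' (key u v hk).ne
    · rw [hk] at h'
      exact e.injective (Fin.ext (Nat.add_left_cancel h'))
    · exact absurd h' (key v u hk).ne'
  · have h' : k u * n + e u < k v * n + e v := Nat.cast_lt.1 h
    exact not_lt.1 fun hk => (h'.trans (key v u hk)).false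

/-- If `e₂` meets `e₃` or is disjoint from `e₁`, then placing the vertices of `e₁` first and the
remaining vertices of `e₂` next leaves no two of the edges `e₁`, `e₂`, `e₃` interleaved. -/
theorem exists_noninterleaving_triple {V : Type*} [Finite V] (e₁ e₂ e₃ : Sym2 V)
    (h : (∃ v, v ∈ e₂ ∧ v ∈ e₃) ∨ ¬ (∃ v, v ∈ e₁ ∧ v ∈ e₂)) :
    ∃ x : V → ℝ, Function.Injective x ∧ ∀ u v w z, s(u, v) ∈ ({e₁, e₂, e₃} : Set (Sym2 V)) →
      s(w, z) ∈ ({e₁, e₂, e₃} : Set (Sym2 V)) → ¬ (x u < x w ∧ x w < x v ∧ x v < x z) := by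
  classical
  obtain ⟨x, hx, hk⟩ := exists_injective_refining
    fun v : V => if v ∈ e₁ then 0 else if v ∈ e₂ then 1 else 2
  refine ⟨x, hx, fun u v w z huv hwz ⟨h1, h2, h3⟩ => ?_⟩
  have huw : u ≠ w := fun h => h1.ne (congrArg x h)
  have hwv : w ≠ v := fun h => h2.ne (congrArg x h)
  have hvz : v ≠ z := fun h => h3.ne (congrArg x h)
  have huz : u ≠ z := fun h => (h1.trans (h2.trans h3)).ne (congrArg x h)
  have k1 := hk _ _ h1
  have k2 := hk _ _ h2
  have k3 := hk _ _ h3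
  simp only [Set.mem_insert_iff, Set.mem_singleton_iff] at huv hwz
  have hne : s(u, v) ≠ s(w, z) := by simp [huw, huz]
  rcases huv with h₁ | h₁ | h₁ <;> rcases hwz with h₂ | h₂ | h₂ <;>
    first
    | exact hne (h₁.trans h₂.symm)
    | (subst h₁ h₂
       simp only [Sym2.mem_iff] at k1 k2 k3 h
       grind)

theorem exists_noninterleaving {V : Type*} [Finite V] {S : Set (Sym2 V)} (hS : S.ncard ≤ 3) :
    ∃ x : V → ℝ, Function.Injective x ∧ ∀ u v w z, s(u, v) ∈ S →
      s(w, z) ∈ S → ¬ (x u < x w ∧ x w < x v ∧ x v < x z) := by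
  classical
  by_cases hne : S.Nonempty
  swap
  · obtain ⟨x, hx, -⟩ := exists_injective_refining fun _ : V => 0
    exact ⟨x, hx, fun u v _ _ h => (hne ⟨_, h⟩).elim⟩
  obtain ⟨e₁, e₂, e₃, hsub⟩ : ∃ e₁ e₂ e₃, S ⊆ ({e₁, e₂, e₃} : Set (Sym2 V)) := by
    obtain ⟨a, ha⟩ := hne
    have h0 : 0 < S.ncard := (Set.ncard_pos).2 ⟨a, ha⟩
    obtain h | h | h : S.ncard = 1 ∨ S.ncard = 2 ∨ S.ncard = 3 := by omega
    · obtain ⟨a, rfl⟩ := Set.ncard_eq_one.1 h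
      exact ⟨a, a, a, by simp⟩
    · obtain ⟨a, b, -, rfl⟩ := Set.ncard_eq_two.1 h
      exact ⟨a, b, b, by simp⟩
    · obtain ⟨a, b, c, -, -, -, rfl⟩ := Set.ncard_eq_three.1 h
      exact ⟨a, b, c, subset_rfl⟩
  suffices ∃ x : V → ℝ, Function.Injective x ∧ ∀ u v w z,
      s(u, v) ∈ ({e₁, e₂, e₃} : Set (Sym2 V)) → s(w, z) ∈ ({e₁, e₂, e₃} : Set (Sym2 V)) →
      ¬ (x u < x w ∧ x w < x v ∧ x v < x z) by
    obtain ⟨x, hx, hi⟩ := this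
    exact ⟨x, hx, fun u v w z h h' => hi u v w z (hsub h) (hsub h')⟩
  by_cases h12 : ∃ v, v ∈ e₁ ∧ v ∈ e₂
  · have := exists_noninterleaving_triple e₃ e₁ e₂ (Or.inl h12)
    rwa [show ({e₃, e₁, e₂} : Set (Sym2 V)) = {e₁, e₂, e₃} by grind] at this
  · exact exists_noninterleaving_triple e₁ e₂ e₃ (Or.inr h12)

theorem crossingNumber_eq_zero_of_ncard_edgeSet_le_three {V : Type*} [Finite V]
    {G : SimpleGraph V} (hG : G.edgeSet.ncard ≤ 3) : crossingNumber G = 0 := by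
  obtain ⟨x, hx, hi⟩ := exists_noninterleaving hG
  exact (Drawing.parabola_s13 G x hx).crossingNumber_eq_zero (Drawing.not_crosses_parabola hi)

/-- A symmetric relation with fewer than ten related ordered pairs has a vertex cover which has
at most three elements or is independent. -/
theorem exists_cover_ncard_le_three_or_independent {α : Type*} [Finite α] {r : α → α → Prop}
    (hsymm : ∀ a b, r a b → r b a) (hirr : ∀ a, ¬ r a a)
    (hcard : {p : α × α | r p.1 p.2}.ncard < 10) :
    ∃ S : Set α, (∀ a b, r a b → a ∈ S ∨ b ∈ S) ∧
      (∀ a ∈ S, ∃ b, r a b) ∧ (S.ncard ≤ 3 ∨ ∀ a ∈ S, ∀ b ∈ S, ¬ r a b) := by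
  classical
  obtain ⟨S, hS⟩ := (Set.toFinite {S : Set α | ∀ a b, r a b → a ∈ S ∨ b ∈ S}).exists_minimal
    ⟨Set.univ, fun a b _ => Or.inl trivial⟩
  have hcov : ∀ a b, r a b → a ∈ S ∨ b ∈ S := hS.prop
  have hpriv : ∀ a ∈ S, ∃ b, b ∉ S ∧ r a b := by
    intro a ha
    by_contra! hno
    have hsub : S ⊆ S \ {a} := hS.le_of_le (y := S \ {a}) (fun b c hbc => by
      have := hcov b c hbc
      have := hsymm b c hbc
      have := hirr a
      grind) Set.sdiff_subset
    exact (hsub ha).2 rfl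
  refine ⟨S, hcov, fun a ha => (hpriv a ha).imp fun _ h => h.2, ?_⟩
  by_contra! hcon
  obtain ⟨hS3, a, ha, b, hb, hab⟩ := hcon
  choose! g hgS hg using hpriv
  set T : Set (α × α) := (fun s => (s, g s)) '' S
  set T' : Set (α × α) := (fun s => (g s, s)) '' S
  have hT : T.ncard = S.ncard := Set.ncard_image_of_injective _ fun s t h => congrArg Prod.fst h
  have hT' : T'.ncard = S.ncard := Set.ncard_image_of_injective _ fun s t h => congrArg Prod.snd h
  have hU : ({(a, b), (b, a)} : Set (α × α)).ncard = 2 :=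
    Set.ncard_pair fun h => hirr a (by have := congrArg Prod.fst h; simp at this; simp_all)
  have hd : Disjoint T T' := by
    rw [Set.disjoint_left]
    rintro _ ⟨s, hs, rfl⟩ ⟨t, ht, h⟩
    have hts : g t = s := congrArg Prod.fst h
    exact hgS t ht (hts ▸ hs)
  have hd' : Disjoint (T ∪ T') {(a, b), (b, a)} := by
    rw [Set.disjoint_left]
    rintro _ (⟨s, hs, rfl⟩ | ⟨s, hs, rfl⟩) h <;> have := hgS s hs <;>
      simp only [Set.mem_insert_iff, Set.mem_singleton_iff, Prod.mk.injEq] at h <;> grind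
  have hle : T ∪ T' ∪ {(a, b), (b, a)} ⊆ {p : α × α | r p.1 p.2} := by
    rintro p ((⟨s, hs, rfl⟩ | ⟨s, hs, rfl⟩) | rfl | rfl)
    · exact hg s hs
    · exact hsymm _ _ (hg s hs)
    · exact hab
    · exact hsymm _ _ hab
  have := Set.ncard_le_ncard hle
  rw [Set.ncard_union_eq hd', Set.ncard_union_eq hd] at this
  omega

theorem kCrossingNumber_two_eq_zero {V : Type*} {G G₁ G₂ : SimpleGraph V} (hG : G₁ ⊔ G₂ = G)
    (hd : Disjoint G₁.edgeSet G₂.edgeSet) (h₁ : crossingNumber G₁ = 0)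
    (h₂ : crossingNumber G₂ = 0) : kCrossingNumber 2 G = 0 := by
  refine Nat.sInf_eq_zero.2 (Or.inl ⟨![G₁, G₂], ?_, ?_, ?_⟩)
  · rw [← hG]
    apply le_antisymm
    · exact iSup_le fun i => by fin_cases i <;> simp
    · exact sup_le (le_iSup ![G₁, G₂] 0) (le_iSup ![G₁, G₂] 1)
  · intro i j hij
    fin_cases i <;> fin_cases j <;> first | exact absurd rfl hij | exact hd | exact hd.symm
  · simp [Fin.sum_univ_two, h₁, h₂]

/-- Every simple graph `G` with `cr(G) ≤ 4` is biplanar, i.e. `cr₂(G) = 0`. -/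
theorem cr_le_four_implies_biplanar {V : Type} [Fintype V] (G : SimpleGraph V)
    (h : crossingNumber G ≤ 4) : kCrossingNumber 2 G = 0 := by
  by_cases hD : Nonempty (Drawing G)
  swap
  · refine kCrossingNumber_two_eq_zero (G₁ := G) (G₂ := ⊥) (by simp) (by simp) ?_
      (crossingNumber_eq_zero_of_ncard_edgeSet_le_three (by simp))
    exact Nat.sInf_eq_zero.2 (Or.inr (Set.eq_empty_of_forall_notMem
      fun _ ⟨D, _⟩ => hD ⟨D⟩))
  obtain ⟨D₀⟩ := hD
  obtain ⟨D, hD⟩ : ∃ D : Drawing G, D.crossCount = crossingNumber G :=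
    Nat.sInf_mem (s := {n : ℕ | ∃ D : Drawing G, D.crossCount = n})
      ⟨D₀.crossCount, D₀, rfl⟩
  have hcard : {p : Sym2 V × Sym2 V | D.Crosses p.1 p.2}.ncard < 10 := by
    unfold Drawing.crossCount at hD
    omega
  obtain ⟨S, hcov, hSr, hS⟩ := exists_cover_ncard_le_three_or_independent
    (r := D.Crosses) (fun _ _ h => h.symm) (fun _ h => h.2.2.1 rfl) hcard
  have hSG : S ⊆ G.edgeSet := fun e he => (hSr e he).choose_spec.1
  have hedge : (fromEdgeSet S).edgeSet = S := by
    rw [edgeSet_fromEdgeSet, sdiff_eq_left, Set.disjoint_left]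
    exact fun e he => G.not_isDiag_of_mem_edgeSet (hSG he)
  have hle : fromEdgeSet S ≤ G := by
    rw [← edgeSet_subset_edgeSet, hedge]
    exact hSG
  refine kCrossingNumber_two_eq_zero (G₁ := G.deleteEdges S) (G₂ := fromEdgeSet S) ?_ ?_ ?_ ?_
  · rw [← edgeSet_inj, edgeSet_sup, hedge, edgeSet_deleteEdges, Set.sdiff_union_of_subset hSG]
  · rw [hedge, edgeSet_deleteEdges]
    exact Set.disjoint_sdiff_left
  · refine (D.restrict (deleteEdges_le S)).crossingNumber_eq_zero fun e f hc => ?_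
    have he := hc.1
    have hf := hc.2.1
    rw [edgeSet_deleteEdges] at he hf
    exact (hcov e f hc.of_restrict).elim he.2 hf.2
  · rcases hS with hS | hS
    · exact crossingNumber_eq_zero_of_ncard_edgeSet_le_three (hedge.symm ▸ hS)
    · refine (D.restrict hle).crossingNumber_eq_zero fun e f hc => ?_
      exact hS e (hedge ▸ hc.1) f (hedge ▸ hc.2.1) hc.of_restrict
end
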